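/- For every a > 0 there exists a point process Φ on ℝ² of intensity a that is dcx-larger than the homogeneous Poisson point process of intensity a and whose Boolean model percolates for every radius r > 0; that is, r_c(Φ) = 0. In particular Φ is a counterexample to the monotonicity of the critical radius r_c with respect to the dcx order, since the Poisson point process of intensity a has strictly positive critical radius. -/

import Mathlib

open MeasureTheory ENNReal Metric

noncomputable section

/-- The plane `ℝ²`. -/
abbrev E2 := EuclideanSpace ℝ (Fin 2)

/-- A subset of the plane percolates if it contains an unbounded connected subset. -/
def Percolates (S : Set E2) : Prop :=
  ∃ C : Set E2, C ⊆ S ∧ IsConnected C ∧ ¬ Bornology.IsBounded C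

/-- The set of atoms (points) of a counting measure. -/
def atomsOf (μ : Measure E2) : Set E2 := {x | μ {x} ≠ 0}

/-- The Boolean model `C(Φ,r) = ⋃_{X ∈ Φ} B_r(X)` of a counting measure. -/
def BooleanModel (μ : Measure E2) (r : ℝ) : Set E2 := ⋃ x ∈ atomsOf μ, closedBall x r

/-- The critical radius for percolation of the Boolean model,
`r_c(Φ) = inf { r : P(C(Φ,r) percolates) > 0 }`. -/
def criticalRadius {Ω : Type*} [MeasurableSpace Ω] (P : Measure Ω)
    (Φ : Ω → Measure E2) : ℝ :=
  sInf {r : ℝ | 0 < P {ω | Percolates (BooleanModel (Φ ω) r)}}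

/-- The Poisson probability `e^{−t} t^n / n!`. -/
def poissonPMF (t : ℝ≥0∞) (n : ℕ) : ℝ≥0∞ :=
  ENNReal.ofReal (Real.exp (-t.toReal) * t.toReal ^ n / n.factorial)

/-- `Φ` is a Poisson point process with intensity measure `m`. -/
def IsPoissonPP {Ω : Type*} [MeasurableSpace Ω] (P : Measure Ω)
    (Φ : Ω → Measure E2) (m : Measure E2) : Prop :=
  Measurable Φ ∧
    ∀ (k : ℕ) (B : Fin k → Set E2),
      (∀ i, MeasurableSet (B i) ∧ Bornology.IsBounded (B i)) →
      Pairwise (Function.onFun Disjoint B) →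
      ∀ n : Fin k → ℕ,
        P {ω | ∀ i, Φ ω (B i) = (n i : ℝ≥0∞)} = ∏ i, poissonPMF (m (B i)) (n i)

/-- `f : ℝ^k → ℝ` is directionally convex: all discrete second-order mixed
differences `Δ_ε^i Δ_δ^j f` are nonnegative. -/
def DirConvex {k : ℕ} (f : (Fin k → ℝ) → ℝ) : Prop :=
  ∀ (x : Fin k → ℝ) (i j : Fin k) (ε δ : ℝ), 0 < ε → 0 < δ →
    f (x + ε • (Pi.single i 1 : Fin k → ℝ)) + f (x + δ • (Pi.single j 1 : Fin k → ℝ))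
      ≤ f x + f (x + ε • (Pi.single i 1 : Fin k → ℝ) + δ • (Pi.single j 1 : Fin k → ℝ))

/-- The dcx order of point processes: `Φ₁ ≤_dcx Φ₂` iff for all bounded Borel sets
`B_1, …, B_k` and every (measurable) directionally convex `f` for which both
expectations exist, `E[f(Φ₁(B_1),…,Φ₁(B_k))] ≤ E[f(Φ₂(B_1),…,Φ₂(B_k))]`. -/
def DcxLE {Ω : Type*} [MeasurableSpace Ω] (P₁ : Measure Ω) (Φ₁ : Ω → Measure E2)
    (P₂ : Measure Ω) (Φ₂ : Ω → Measure E2) : Prop :=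
  ∀ (k : ℕ) (B : Fin k → Set E2),
    (∀ i, MeasurableSet (B i) ∧ Bornology.IsBounded (B i)) →
    ∀ f : (Fin k → ℝ) → ℝ, Measurable f → DirConvex f →
      Integrable (fun ω => f (fun i => (Φ₁ ω (B i)).toReal)) P₁ →
      Integrable (fun ω => f (fun i => (Φ₂ ω (B i)).toReal)) P₂ →
      ∫ ω, f (fun i => (Φ₁ ω (B i)).toReal) ∂P₁
        ≤ ∫ ω, f (fun i => (Φ₂ ω (B i)).toReal) ∂P₂

lemma DirConvex.single_nonneg {k : ℕ} {f : (Fin k → ℝ) → ℝ} (hf : DirConvex f)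
    (x : Fin k → ℝ) (i j : Fin k) {ε δ : ℝ} (hε : 0 ≤ ε) (hδ : 0 ≤ δ) :
    f (x + Pi.single i ε) + f (x + Pi.single j δ)
      ≤ f x + f (x + Pi.single i ε + Pi.single j δ) := by
  rcases hε.eq_or_lt with rfl | hε
  · simp
  rcases hδ.eq_or_lt with rfl | hδ
  · simp [add_comm]
  have h := hf x i j ε δ hε hδ
  simpa only [← Pi.single_smul, smul_eq_mul, mul_one] using h

lemma DirConvex.single_add {k : ℕ} {f : (Fin k → ℝ) → ℝ} (hf : DirConvex f)
    (x : Fin k → ℝ) (i : Fin k) {ε : ℝ} (hε : 0 ≤ ε) {v : Fin k → ℝ} (hv : 0 ≤ v) :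
    f (x + Pi.single i ε) + f (x + v) ≤ f x + f (x + Pi.single i ε + v) := by
  suffices H : ∀ s : Finset (Fin k),
      f (x + Pi.single i ε) + f (x + ∑ j ∈ s, Pi.single j (v j))
        ≤ f x + f (x + Pi.single i ε + ∑ j ∈ s, Pi.single j (v j)) by
    simpa [Finset.univ_sum_single] using H Finset.univ
  intro s
  induction s using Finset.induction_on with
  | empty => simp [add_comm]
  | insert j s hj ih =>
    have h := hf.single_nonneg (x + ∑ j ∈ s, Pi.single j (v j)) i j hε (hv j)
    rw [Finset.sum_insert hj, add_comm (Pi.single j (v j) : Fin k → ℝ)]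
    simp only [← add_assoc] at *
    rw [add_right_comm x _ (Pi.single i ε)] at h
    linarith

/-- A directionally convex function has supermodular increments along nonnegative vectors. -/
lemma DirConvex.add_add_le {k : ℕ} {f : (Fin k → ℝ) → ℝ} (hf : DirConvex f)
    (x : Fin k → ℝ) {u v : Fin k → ℝ} (hu : 0 ≤ u) (hv : 0 ≤ v) :
    f (x + u) + f (x + v) ≤ f x + f (x + u + v) := by
  suffices H : ∀ s : Finset (Fin k),
      f (x + ∑ j ∈ s, Pi.single j (u j)) + f (x + v)
        ≤ f x + f (x + ∑ j ∈ s, Pi.single j (u j) + v) by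
    simpa [Finset.univ_sum_single] using H Finset.univ
  intro s
  induction s using Finset.induction_on with
  | empty => simp
  | insert j s hj ih =>
    have h := hf.single_add (x + ∑ j ∈ s, Pi.single j (u j)) j (hu j) hv
    rw [Finset.sum_insert hj, add_comm (Pi.single j (u j) : Fin k → ℝ)]
    simp only [← add_assoc] at *
    linarith

/-! ### Hierarchical renormalization on `ℤ × ℤ` -/

/-- The `d`-th site of the `3 × 3` block with index `b`. -/
def subBlock (b : ℤ × ℤ) (d : Fin 3 × Fin 3) : ℤ × ℤ :=
  (3 * b.1 + (d.1 : ℕ), 3 * b.2 + (d.2 : ℕ))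

/-- Two sites are equal or nearest neighbours. -/
def Nbr (x y : ℤ × ℤ) : Prop := (x.1 - y.1).natAbs + (x.2 - y.2).natAbs ≤ 1

lemma Nbr.symm {x y : ℤ × ℤ} (h : Nbr x y) : Nbr y x := by
  unfold Nbr at *; omega

lemma subBlock_inj {b b' : ℤ × ℤ} {d d' : Fin 3 × Fin 3} :
    subBlock b d = subBlock b' d' ↔ b = b' ∧ d = d' := by
  obtain ⟨b1, b2⟩ := b
  obtain ⟨b1', b2'⟩ := b'
  obtain ⟨d1, d2⟩ := d
  obtain ⟨d1', d2'⟩ := d'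
  simp only [subBlock, Prod.mk.injEq, Fin.ext_iff]
  have := d1.2; have := d2.2; have := d1'.2; have := d2'.2
  omega

/-- The next site on a path inside the `3 × 3` block which avoids `e`. -/
def blockStep (e d : Fin 3 × Fin 3) : Fin 3 × Fin 3 :=
  if e = (1, 1) then
    if d.1 = 0 then (0, if d.2 = 2 then 1 else 0)
    else if d.2 = 1 then (d.1, 0)
    else (d.1 - 1, d.2)
  else if d.1 ≠ 1 ∧ (1, d.2) ≠ e then (1, d.2) else (d.1, 1)

/-- The site to which all sites of the `3 × 3` block different from `e` are led by `blockStep`. -/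
def blockRoot (e : Fin 3 × Fin 3) : Fin 3 × Fin 3 := if e = (1, 1) then (0, 0) else (1, 1)

/-- Adjacency (or equality) inside the `3 × 3` block. -/
def BlockNbr (d d' : Fin 3 × Fin 3) : Prop :=
  ((d.1 : ℤ) - (d'.1 : ℤ)).natAbs + ((d.2 : ℤ) - (d'.2 : ℤ)).natAbs ≤ 1

instance : DecidableRel BlockNbr := fun _ _ => inferInstanceAs (Decidable (_ ≤ _))

lemma BlockNbr.symm {d d' : Fin 3 × Fin 3} (h : BlockNbr d d') : BlockNbr d' d := by
  unfold BlockNbr at *; omega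

lemma BlockNbr.nbr {d d' : Fin 3 × Fin 3} (h : BlockNbr d d') (b : ℤ × ℤ) :
    Nbr (subBlock b d) (subBlock b d') := by
  unfold BlockNbr at h
  simp only [Nbr, subBlock]
  omega

lemma blockStep_spec : ∀ e d : Fin 3 × Fin 3, d ≠ e → blockStep e d ≠ e ∧
    BlockNbr d (blockStep e d) ∧ (blockStep e)^[4] d = blockRoot e := by
  decide

lemma exists_blockNbr_ne : ∀ e : Fin 3 × Fin 3, ∃ d, d ≠ e ∧ BlockNbr e d := by
  decide

/-- A `3 × 3` block with at most one defective site is connected. -/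
lemma block_connected {g : Fin 3 × Fin 3 → Prop} (hg : ∀ d d', d ≠ d' → g d ∨ g d')
    {d d' : Fin 3 × Fin 3} (hd : g d) (hd' : g d') :
    Relation.ReflTransGen (fun x y => g x ∧ g y ∧ BlockNbr x y) d d' := by
  obtain ⟨e, he⟩ : ∃ e, ∀ d, d ≠ e → g d := by
    by_cases h : ∃ e, ¬ g e
    · obtain ⟨e, he⟩ := h
      exact ⟨e, fun d hd => (hg d e hd).resolve_right he⟩
    · push Not at h
      exact ⟨d, fun d _ => h d⟩
  have key : ∀ n d, d ≠ e →
      Relation.ReflTransGen (fun x y => g x ∧ g y ∧ BlockNbr x y) d ((blockStep e)^[n] d) := by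
    intro n
    induction n with
    | zero => exact fun d _ => .refl
    | succ n ih =>
      intro d hd
      obtain ⟨h1, h2, -⟩ := blockStep_spec e d hd
      exact .head ⟨he d hd, he _ h1, h2⟩ (ih _ h1)
  have toRoot : ∀ d, g d →
      Relation.ReflTransGen (fun x y => g x ∧ g y ∧ BlockNbr x y) d (blockRoot e) := by
    intro d hd
    by_cases hde : d = e
    · obtain ⟨d1, h1, h2⟩ := exists_blockNbr_ne e
      subst hde
      refine .head ⟨hd, he _ h1, h2⟩ ?_
      rw [← (blockStep_spec d d1 h1).2.2]
      exact key 4 d1 h1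
    · rw [← (blockStep_spec e d hde).2.2]
      exact key 4 d hde
  refine (toRoot d hd).trans ?_
  have := (toRoot d' hd').swap
  exact Relation.ReflTransGen.mono (fun x y h => ⟨h.2.1, h.1, h.2.2.symm⟩) _ _ this

/-- The set of sites of a `k`-th level block spanned by its good sub-blocks. -/
def core (op : ℕ → ℤ × ℤ → Prop) : ℕ → ℤ × ℤ → Set (ℤ × ℤ)
  | 0, b => {b}
  | k + 1, b => {x | ∃ d, op k (subBlock b d) ∧ x ∈ core op k (subBlock b d)}

section Hierarchy

variable {op : ℕ → ℤ × ℤ → Prop}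

lemma core_nonempty (H : ∀ k b d d', op (k + 1) b → d ≠ d' →
      op k (subBlock b d) ∨ op k (subBlock b d')) :
    ∀ k b, op k b → (core op k b).Nonempty := by
  intro k
  induction k with
  | zero => exact fun b _ => ⟨b, rfl⟩
  | succ k ih =>
    intro b hb
    rcases H k b (0, 0) (0, 1) hb (by decide) with h | h
    · obtain ⟨x, hx⟩ := ih _ h
      exact ⟨x, _, h, hx⟩
    · obtain ⟨x, hx⟩ := ih _ h
      exact ⟨x, _, h, hx⟩

lemma le_of_mem_core : ∀ k b x, x ∈ core op k b → 3 ^ k * b.1 ≤ x.1 := by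
  intro k
  induction k with
  | zero =>
    rintro b x rfl
    simp
  | succ k ih =>
    rintro b x ⟨d, -, hx⟩
    have h := ih _ _ hx
    refine le_trans ?_ h
    simp only [subBlock, pow_succ]
    have : (0 : ℤ) ≤ 3 ^ k * (d.1 : ℕ) := by positivity
    linarith

/-- Two good sub-blocks of neighbouring good blocks can be chosen to be neighbours. -/
lemma exists_nbr_subBlock {k : ℕ} (H : ∀ b d d', op (k + 1) b → d ≠ d' →
      op k (subBlock b d) ∨ op k (subBlock b d'))
    {b b' : ℤ × ℤ} (hn : Nbr b b') (hb : op (k + 1) b) (hb' : op (k + 1) b') :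
    ∃ d d', op k (subBlock b d) ∧ op k (subBlock b' d') ∧
      Nbr (subBlock b d) (subBlock b' d') := by
  have pick : ∀ u u' : Fin 3 → Fin 3 × Fin 3, Function.Injective u → Function.Injective u' →
      ∃ r, op k (subBlock b (u r)) ∧ op k (subBlock b' (u' r)) := by
    intro u u' hu hu'
    by_contra! hcon
    have h01 := H b (u 0) (u 1) hb (hu.ne (by decide))
    have h02 := H b (u 0) (u 2) hb (hu.ne (by decide))
    have h12 := H b (u 1) (u 2) hb (hu.ne (by decide))
    have h01' := H b' (u' 0) (u' 1) hb' (hu'.ne (by decide))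
    have h02' := H b' (u' 0) (u' 2) hb' (hu'.ne (by decide))
    have h12' := H b' (u' 1) (u' 2) hb' (hu'.ne (by decide))
    have c0 := hcon 0
    have c1 := hcon 1
    have c2 := hcon 2
    tauto
  have i1 : ∀ c : Fin 3, Function.Injective fun r : Fin 3 => (c, r) := by decide
  have i2 : ∀ c : Fin 3, Function.Injective fun r : Fin 3 => (r, c) := by decide
  have hcases : (b'.1 = b.1 ∧ b'.2 = b.2) ∨ (b'.1 = b.1 + 1 ∧ b'.2 = b.2) ∨
      (b'.1 = b.1 - 1 ∧ b'.2 = b.2) ∨ (b'.1 = b.1 ∧ b'.2 = b.2 + 1) ∨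
      (b'.1 = b.1 ∧ b'.2 = b.2 - 1) := by
    unfold Nbr at hn; omega
  rcases hcases with h | h | h | h | h
  · obtain ⟨r, h1, h2⟩ := pick _ _ (i1 0) (i1 0)
    exact ⟨_, _, h1, h2, by simp [Nbr, subBlock]; omega⟩
  · obtain ⟨r, h1, h2⟩ := pick _ _ (i1 2) (i1 0)
    exact ⟨_, _, h1, h2, by simp [Nbr, subBlock]; omega⟩
  · obtain ⟨r, h1, h2⟩ := pick _ _ (i1 0) (i1 2)
    exact ⟨_, _, h1, h2, by simp [Nbr, subBlock]; omega⟩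
  · obtain ⟨r, h1, h2⟩ := pick _ _ (i2 2) (i2 0)
    exact ⟨_, _, h1, h2, by simp [Nbr, subBlock]; omega⟩
  · obtain ⟨r, h1, h2⟩ := pick _ _ (i2 0) (i2 2)
    exact ⟨_, _, h1, h2, by simp [Nbr, subBlock]; omega⟩

lemma core_connected (H : ∀ k b d d', op (k + 1) b → d ≠ d' →
      op k (subBlock b d) ∨ op k (subBlock b d')) :
    ∀ k b b', Nbr b b' → op k b → op k b' → ∀ x ∈ core op k b, ∀ y ∈ core op k b',
      Relation.ReflTransGen (fun x y => op 0 x ∧ op 0 y ∧ Nbr x y) x y := by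
  intro k
  induction k with
  | zero =>
    rintro b b' hn hb hb' x rfl y rfl
    exact .single ⟨hb, hb', hn⟩
  | succ k ih =>
    have inBlock : ∀ b, op (k + 1) b → ∀ d d', op k (subBlock b d) → op k (subBlock b d') →
        ∀ x ∈ core op k (subBlock b d), ∀ y ∈ core op k (subBlock b d'),
          Relation.ReflTransGen (fun x y => op 0 x ∧ op 0 y ∧ Nbr x y) x y := by
      intro b hb d d' hd hd'
      have hpath := block_connected (g := fun d => op k (subBlock b d))
        (fun d d' hdd => H k b d d' hb hdd) hd hd'
      clear hd'
      induction hpath with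
      | refl => exact ih _ _ (by simp [Nbr]) hd hd
      | tail _ hstep ih2 =>
        obtain ⟨h1, h2, h3⟩ := hstep
        intro x hx y hy
        obtain ⟨z, hz⟩ := core_nonempty H k _ h1
        exact (ih2 x hx z hz).trans (ih _ _ (h3.nbr b) h1 h2 z hz y hy)
    rintro b b' hn hb hb' x ⟨d, hd, hx⟩ y ⟨d', hd', hy⟩
    obtain ⟨e, e', he, he', hee⟩ := exists_nbr_subBlock (H k) hn hb hb'
    obtain ⟨z, hz⟩ := core_nonempty H k _ he
    obtain ⟨z', hz'⟩ := core_nonempty H k _ he'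
    exact ((inBlock b hb d e hd he x hx z hz).trans (ih _ _ hee he he' z hz z' hz')).trans
      (inBlock b' hb' e' d' he' hd' z' hz' y hy)

/-- If the blocks at the origin are good at all levels, the origin is connected to infinity. -/
lemma exists_far_connected (H : ∀ k b d d', op (k + 1) b → d ≠ d' →
      op k (subBlock b d) ∨ op k (subBlock b d')) (h0 : ∀ k, op k 0) (n : ℕ) :
    ∃ y : ℤ × ℤ, (n : ℤ) ≤ y.1 ∧
      Relation.ReflTransGen (fun x y => op 0 x ∧ op 0 y ∧ Nbr x y) 0 y := by
  have hzero : subBlock 0 (0, 0) = 0 := by simp [subBlock]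
  have hmem : ∀ k, (0 : ℤ × ℤ) ∈ core op k 0 := by
    intro k
    induction k with
    | zero => rfl
    | succ k ih => exact ⟨(0, 0), by rw [hzero]; exact h0 k, by rwa [hzero]⟩
  obtain ⟨r, hr⟩ : ∃ r : Fin 3, op n (subBlock 0 (2, r)) := by
    rcases H n 0 (2, 0) (2, 1) (h0 _) (by decide) with h | h
    · exact ⟨_, h⟩
    · exact ⟨_, h⟩
  obtain ⟨y, hy⟩ := core_nonempty H n _ hr
  refine ⟨y, ?_, core_connected H (n + 1) 0 0 (by simp [Nbr]) (h0 _) (h0 _) 0 (hmem _) y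
    ⟨_, hr, hy⟩⟩
  have h := le_of_mem_core _ _ _ hy
  have h3 : (n : ℤ) < 3 ^ n := by exact_mod_cast Nat.lt_pow_self (by norm_num)
  simp [subBlock] at h
  linarith

end Hierarchy

/-- A block is bad if two distinct sites in it are bad. -/
def renormSet {Ω : Type*} (A : ℤ × ℤ → Set Ω) (b : ℤ × ℤ) : Set Ω :=
  ⋃ p : {p : (Fin 3 × Fin 3) × (Fin 3 × Fin 3) // p.1 ≠ p.2},
    A (subBlock b p.1.1) ∩ A (subBlock b p.1.2)

/-- All finite intersections of the events `A x` have probability at most that of independent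
events of probability `q`. -/
def SubIndep {Ω ι : Type*} [MeasurableSpace Ω] (P : Measure Ω) (A : ι → Set Ω)
    (q : ℝ≥0∞) : Prop :=
  ∀ S : Finset ι, P (⋂ b ∈ S, A b) ≤ q ^ S.card

lemma SubIndep.renorm {Ω : Type*} [MeasurableSpace Ω] {P : Measure Ω} {A : ℤ × ℤ → Set Ω}
    {q : ℝ≥0∞} (h : SubIndep P A q) : SubIndep P (renormSet A) (81 * q ^ 2) := by
  classical
  intro S
  let Pair := {p : (Fin 3 × Fin 3) × (Fin 3 × Fin 3) // p.1 ≠ p.2}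
  let f : (S → Pair) → S × Bool → ℤ × ℤ := fun p z =>
    subBlock z.1 (if z.2 then (p z.1).1.1 else (p z.1).1.2)
  have hf : ∀ p, Function.Injective (f p) := by
    rintro p ⟨b, s⟩ ⟨b', s'⟩ hz
    obtain ⟨h1, h2⟩ := subBlock_inj.1 hz
    obtain rfl : b = b' := Subtype.ext h1
    have hp := (p b).2
    cases s <;> cases s' <;> simp_all
  have hsub : (⋂ b ∈ S, renormSet A b) ⊆
      ⋃ p : S → Pair, ⋂ x ∈ Finset.univ.image (f p), A x := by
    intro ω hω
    simp only [Set.mem_iInter, renormSet, Set.mem_iUnion] at hω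
    choose g hg using hω
    refine Set.mem_iUnion.2 ⟨fun b => g b.1 b.2, ?_⟩
    simp only [Set.mem_iInter, Finset.mem_image, Finset.mem_univ, true_and]
    rintro _ ⟨⟨b, s⟩, rfl⟩
    cases s
    · exact (hg b.1 b.2).2
    · exact (hg b.1 b.2).1
  have hcard : Fintype.card Pair ≤ 81 := (Fintype.card_subtype_le _).trans (by simp)
  calc P (⋂ b ∈ S, renormSet A b)
      ≤ ∑ p : S → Pair, P (⋂ x ∈ Finset.univ.image (f p), A x) :=
        (measure_mono hsub).trans (measure_iUnion_fintype_le _ _)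
    _ ≤ ∑ p : S → Pair, q ^ (2 * S.card) := by
        refine Finset.sum_le_sum fun p _ => (h _).trans_eq ?_
        rw [Finset.card_image_of_injective _ (hf p)]
        simp [mul_comm]
    _ = (Fintype.card Pair : ℝ≥0∞) ^ S.card * q ^ (2 * S.card) := by
        simp [Finset.sum_const]
    _ ≤ 81 ^ S.card * q ^ (2 * S.card) := by
        gcongr
        exact_mod_cast hcard
    _ = (81 * q ^ 2) ^ S.card := by rw [mul_pow, ← pow_mul]

lemma SubIndep.measure_iterate_renorm_le {Ω : Type*} [MeasurableSpace Ω] {P : Measure Ω}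
    {A : ℤ × ℤ → Set Ω} {q : ℝ≥0∞} (h : SubIndep P A q) (hq : 81 * q ≤ 3⁻¹) (k : ℕ) (b : ℤ × ℤ) :
    P (renormSet^[k] A b) ≤ 3⁻¹ ^ (k + 1) := by
  have key : ∃ c : ℝ≥0∞, SubIndep P (renormSet^[k] A) c ∧ 81 * c ≤ 3⁻¹ ^ (k + 1) := by
    induction k with
    | zero => exact ⟨q, h, by simpa using hq⟩
    | succ k ih =>
      obtain ⟨c, hc, hck⟩ := ih
      refine ⟨81 * c ^ 2, ?_, ?_⟩
      · rw [Function.iterate_succ_apply']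
        exact hc.renorm
      · have h3 : (3⁻¹ : ℝ≥0∞) ≤ 1 := by simp
        calc 81 * (81 * c ^ 2) = (81 * c) * (81 * c) := by ring
          _ ≤ 3⁻¹ ^ (k + 1) * 3⁻¹ ^ (k + 1) := by gcongr
          _ ≤ 3⁻¹ ^ (k + 1) * 3⁻¹ := by
              gcongr
              exact pow_le_of_le_one (by simp) h3 (by simp)
          _ = 3⁻¹ ^ (k + 1 + 1) := (pow_succ _ _).symm
  obtain ⟨c, hc, hck⟩ := key
  have h1 := hc {b}
  simp only [Finset.mem_singleton, Set.iInter_iInter_eq_left, Finset.card_singleton,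
    pow_one] at h1
  refine h1.trans (le_trans ?_ hck)
  exact le_mul_of_one_le_left (by simp) (by norm_num)

/-- Highly supercritical site percolation: with positive probability, the origin is
connected to infinity through sites outside of the bad events. -/
lemma SubIndep.exists_infinite_cluster {Ω : Type*} [MeasurableSpace Ω] {P : Measure Ω}
    [IsProbabilityMeasure P] {A : ℤ × ℤ → Set Ω} {q : ℝ≥0∞} (h : SubIndep P A q)
    (hq : 81 * q ≤ 3⁻¹) :
    0 < P {ω | ∀ n : ℕ, ∃ y : ℤ × ℤ, (n : ℤ) ≤ y.1 ∧
      Relation.ReflTransGen (fun x y => ω ∉ A x ∧ ω ∉ A y ∧ Nbr x y) 0 y} := by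
  have hbad : P (⋃ k, renormSet^[k] A 0) ≤ 2⁻¹ := by
    calc P (⋃ k, renormSet^[k] A 0) ≤ ∑' k, P (renormSet^[k] A 0) := measure_iUnion_le _
      _ ≤ ∑' k : ℕ, (3⁻¹ : ℝ≥0∞) ^ (k + 1) :=
          ENNReal.tsum_le_tsum fun k => h.measure_iterate_renorm_le hq k 0
      _ = 2⁻¹ := by
          rw [ENNReal.tsum_geometric_add_one]
          have : (1 : ℝ≥0∞) - 3⁻¹ = 2 * 3⁻¹ := by
            refine ENNReal.sub_eq_of_eq_add (by simp) ?_
            rw [← add_one_mul, show (2 : ℝ≥0∞) + 1 = 3 by norm_num,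
              ENNReal.mul_inv_cancel (by simp) (by simp)]
          rw [this, ENNReal.mul_inv (by simp) (by simp), inv_inv, mul_comm, mul_assoc,
            ENNReal.mul_inv_cancel (by simp) (by simp), mul_one]
  have hgood : (⋃ k, renormSet^[k] A 0)ᶜ ⊆ {ω | ∀ n : ℕ, ∃ y : ℤ × ℤ, (n : ℤ) ≤ y.1 ∧
      Relation.ReflTransGen (fun x y => ω ∉ A x ∧ ω ∉ A y ∧ Nbr x y) 0 y} := by
    intro ω hω n
    refine exists_far_connected (op := fun k b => ω ∉ renormSet^[k] A b) ?_ ?_ n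
    · intro k b d d' hb hdd
      by_contra! hcon
      rw [Function.iterate_succ_apply'] at hb
      exact hb (Set.mem_iUnion.2 ⟨⟨(d, d'), hdd⟩, hcon.1, hcon.2⟩)
    · intro k hk
      exact hω (Set.mem_iUnion.2 ⟨k, hk⟩)
  refine lt_of_lt_of_le ?_ (measure_mono hgood)
  rw [pos_iff_ne_zero]
  intro h0
  have h1 : (1 : ℝ≥0∞) ≤ 2⁻¹ + 0 := by
    calc (1 : ℝ≥0∞) = P Set.univ := measure_univ.symm
      _ ≤ P (⋃ k, renormSet^[k] A 0) + P (⋃ k, renormSet^[k] A 0)ᶜ := by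
          rw [← Set.union_compl_self (⋃ k, renormSet^[k] A 0)]
          exact measure_union_le _ _
      _ ≤ 2⁻¹ + 0 := add_le_add hbad h0.le
  rw [add_zero] at h1
  exact absurd h1 (not_le.2 (by simp [ENNReal.inv_lt_one]))

/-! ### Square cells of the plane -/

/-- The index of the square cell of side `s` which contains `x`. -/
def cellIndex (s : ℝ) (x : E2) : ℤ × ℤ := (⌊x 0 / s⌋, ⌊x 1 / s⌋)

/-- The half-open square cell of side `s` with index `c`. -/
def cell (s : ℝ) (c : ℤ × ℤ) : Set E2 := cellIndex s ⁻¹' {c}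

lemma measurable_cellIndex (s : ℝ) : Measurable (cellIndex s) := by
  unfold cellIndex
  fun_prop

lemma measurableSet_cell (s : ℝ) (c : ℤ × ℤ) : MeasurableSet (cell s c) :=
  measurable_cellIndex s (measurableSet_singleton c)

lemma mem_cell_iff {s : ℝ} (hs : 0 < s) {c : ℤ × ℤ} {x : E2} :
    x ∈ cell s c ↔ (c.1 * s ≤ x 0 ∧ x 0 < (c.1 + 1) * s) ∧
      (c.2 * s ≤ x 1 ∧ x 1 < (c.2 + 1) * s) := by
  simp only [cell, cellIndex, Set.mem_preimage, Set.mem_singleton_iff, Prod.ext_iff,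
    Int.floor_eq_iff, le_div_iff₀ hs, div_lt_iff₀ hs]

lemma pairwise_disjoint_cell (s : ℝ) : Pairwise (Function.onFun Disjoint (cell s)) := by
  intro c c' h
  refine Set.disjoint_left.2 fun x hx hx' => h ?_
  exact hx.symm.trans hx'

lemma iUnion_cell (s : ℝ) : ⋃ c, cell s c = Set.univ :=
  Set.eq_univ_of_forall fun x => Set.mem_iUnion.2 ⟨cellIndex s x, rfl⟩

lemma cell_eq_preimage {s : ℝ} (hs : 0 < s) (c : ℤ × ℤ) :
    cell s c = (MeasurableEquiv.toLp 2 (Fin 2 → ℝ)).symm ⁻¹'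
      Set.pi Set.univ ![Set.Ico (c.1 * s) ((c.1 + 1) * s), Set.Ico (c.2 * s) ((c.2 + 1) * s)] := by
  ext x
  rw [mem_cell_iff hs]
  simp [Set.mem_pi, Fin.forall_fin_two]

lemma volume_cell {s : ℝ} (hs : 0 < s) (c : ℤ × ℤ) :
    volume (cell s c) = ENNReal.ofReal (s ^ 2) := by
  rw [cell_eq_preimage hs, (EuclideanSpace.volume_preserving_symm_measurableEquiv_toLp
    (Fin 2)).measure_preimage_equiv, volume_pi, Measure.pi_pi]
  simp only [Fin.prod_univ_two, Matrix.cons_val_zero, Matrix.cons_val_one, Real.volume_Ico]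
  rw [← ENNReal.ofReal_mul (by nlinarith)]
  congr 1
  ring

lemma dist_lt_of_forall {x y : E2} {δ : ℝ} (h : ∀ i, |x i - y i| < 2 * δ) :
    dist x y ≤ 3 * δ := by
  have hδ : 0 < δ := by have := abs_nonneg (x 0 - y 0); linarith [h 0]
  rw [EuclideanSpace.dist_eq, Fin.sum_univ_two]
  refine Real.sqrt_le_iff.2 ⟨by positivity, ?_⟩
  have h0 := abs_lt.1 (h 0)
  have h1 := abs_lt.1 (h 1)
  simp only [Real.dist_eq, sq_abs]
  nlinarith

lemma dist_le_of_nbr {s : ℝ} (hs : 0 < s) {c c' : ℤ × ℤ} (hc : Nbr c c') {x y : E2}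
    (hx : x ∈ cell s c) (hy : y ∈ cell s c') : dist x y ≤ 3 * s := by
  rw [mem_cell_iff hs] at hx hy
  obtain ⟨h1, h2, h3, h4⟩ : c.1 ≤ c'.1 + 1 ∧ c'.1 ≤ c.1 + 1 ∧ c.2 ≤ c'.2 + 1 ∧ c'.2 ≤ c.2 + 1 := by
    unfold Nbr at hc; omega
  have h1' : (c.1 : ℝ) ≤ c'.1 + 1 := by exact_mod_cast h1
  have h2' : (c'.1 : ℝ) ≤ c.1 + 1 := by exact_mod_cast h2
  have h3' : (c.2 : ℝ) ≤ c'.2 + 1 := by exact_mod_cast h3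
  have h4' : (c'.2 : ℝ) ≤ c.2 + 1 := by exact_mod_cast h4
  refine dist_lt_of_forall fun i => ?_
  fin_cases i
  · simp only [Fin.zero_eta, abs_lt]
    constructor <;> nlinarith
  · simp only [Fin.mk_one, abs_lt]
    constructor <;> nlinarith

lemma abs_apply_le_norm (x : E2) (i : Fin 2) : |x i| ≤ ‖x‖ := by
  simpa using PiLp.norm_apply_le x i

lemma Bornology.IsBounded.cell {s : ℝ} (hs : 0 < s) (c : ℤ × ℤ) :
    Bornology.IsBounded (cell s c) := by
  refine Metric.isBounded_iff.2 ⟨3 * s, fun x hx y hy => ?_⟩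
  exact dist_le_of_nbr hs (by simp [Nbr]) hx hy

/-- A bounded set meets only finitely many cells. -/
lemma exists_finset_cell {s : ℝ} (hs : 0 < s) {B : Set E2} (hB : Bornology.IsBounded B) :
    ∃ F : Finset (ℤ × ℤ), ∀ c ∉ F, B ∩ _root_.cell s c = ∅ := by
  obtain ⟨R, hR⟩ := hB.subset_closedBall 0
  let m : ℤ := ⌈R / s⌉ + 1
  refine ⟨Finset.Icc (-m, -m) (m, m), fun c hc => ?_⟩
  by_contra hne
  obtain ⟨x, hxB, hxc⟩ := Set.nonempty_iff_ne_empty.2 hne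
  have hx : ‖x‖ ≤ R := by simpa using hR hxB
  have h0 := abs_le.1 ((abs_apply_le_norm x 0).trans hx)
  have h1 := abs_le.1 ((abs_apply_le_norm x 1).trans hx)
  rw [mem_cell_iff hs] at hxc
  have hm : R ≤ (m - 1) * s := by
    have := (div_le_iff₀ hs).1 (Int.le_ceil (R / s))
    simpa [m] using this
  have key : ∀ (z : ℤ) (t : ℝ), -R ≤ t → t ≤ R → z * s ≤ t → t < (z + 1) * s →
      -m ≤ z ∧ z ≤ m := by
    intro z t h1 h2 h3 h4
    have h5 : -((m : ℝ) - 1) < z + 1 := lt_of_mul_lt_mul_right (by nlinarith) hs.le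
    have h6 : (z : ℝ) ≤ m - 1 := le_of_mul_le_mul_right (by linarith) hs
    have h5' : -(m - 1) < z + 1 := by exact_mod_cast h5
    have h6' : z ≤ m - 1 := by exact_mod_cast h6
    omega
  refine hc ?_
  have k1 := key c.1 (x 0) h0.1 h0.2 hxc.1.1 hxc.1.2
  have k2 := key c.2 (x 1) h1.1 h1.2 hxc.2.1 hxc.2.2
  rw [Finset.mem_Icc]
  exact ⟨⟨k1.1, k2.1⟩, ⟨k1.2, k2.2⟩⟩

/-! ### Percolation from an infinite cluster of occupied cells -/

lemma percolates_of_cluster {μ : Measure E2} {s r : ℝ} (hs : 0 < s) (hr : 3 * s ≤ r)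
    (hatom : ∀ c, μ (cell s c) ≠ 0 → ∃ x ∈ cell s c, μ {x} ≠ 0)
    (hcl : ∀ n : ℕ, ∃ y : ℤ × ℤ, (n : ℤ) ≤ y.1 ∧ Relation.ReflTransGen
      (fun x y => μ (cell s x) ≠ 0 ∧ μ (cell s y) ≠ 0 ∧ Nbr x y) 0 y) :
    Percolates (BooleanModel μ r) := by
  choose! p hp hpμ using hatom
  have hr0 : 0 ≤ r := by linarith
  have hball : ∀ c, μ (cell s c) ≠ 0 → closedBall (p c) r ⊆ BooleanModel μ r := fun c hc =>
    Set.subset_biUnion_of_mem (u := fun x => closedBall x r) (show p c ∈ atomsOf μ from hpμ c hc)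
  have h0 : μ (cell s 0) ≠ 0 := by
    obtain ⟨y, hy, hchain⟩ := hcl 1
    rcases hchain.cases_head with h | ⟨z, hz, -⟩
    · subst h
      simp at hy
    · exact hz.1
  have hp0 : p 0 ∈ BooleanModel μ r := hball 0 h0 (mem_closedBall_self hr0)
  have hmem : ∀ y, Relation.ReflTransGen
      (fun x y => μ (cell s x) ≠ 0 ∧ μ (cell s y) ≠ 0 ∧ Nbr x y) 0 y →
      μ (cell s y) ≠ 0 ∧ p y ∈ connectedComponentIn (BooleanModel μ r) (p 0) := by
    intro y hy
    induction hy with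
    | refl => exact ⟨h0, mem_connectedComponentIn hp0⟩
    | @tail b c _ hstep ih =>
      refine ⟨hstep.2.1, ?_⟩
      rw [connectedComponentIn_eq ih.2]
      refine (convex_closedBall (p b) r).isPreconnected.subset_connectedComponentIn
        (mem_closedBall_self hr0) (hball b hstep.1) ?_
      exact (dist_le_of_nbr hs hstep.2.2.symm (hp c hstep.2.1) (hp b hstep.1)).trans hr
  refine ⟨connectedComponentIn (BooleanModel μ r) (p 0), connectedComponentIn_subset _ _,
    isConnected_connectedComponentIn_iff.2 hp0, fun hbdd => ?_⟩
  obtain ⟨R, hR⟩ := hbdd.subset_closedBall 0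
  obtain ⟨n, hn⟩ := exists_nat_gt (R / s)
  obtain ⟨y, hny, hy⟩ := hcl n
  obtain ⟨hyμ, hyC⟩ := hmem y hy
  have h1 : ‖p y‖ ≤ R := by simpa using hR hyC
  have h2 := (le_abs_self _).trans ((abs_apply_le_norm (p y) 0).trans h1)
  have h3 := ((mem_cell_iff hs).1 (hp y hyμ)).1.1
  have h4 : (n : ℝ) ≤ y.1 := by exact_mod_cast hny
  rw [div_lt_iff₀ hs] at hn
  nlinarith

/-! ### Absence of percolation at low density -/

/-- The neighbour of `c` (with diagonals) in direction `d`. -/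
def kingMove (c : ℤ × ℤ) (d : Fin 3 × Fin 3) : ℤ × ℤ :=
  (c.1 + ((d.1 : ℕ) : ℤ) - 1, c.2 + ((d.2 : ℕ) : ℤ) - 1)

/-- There is a self-avoiding path of `n` king moves in the occupied sites which starts at `c`
and avoids `T`. -/
def HasPath (occ : ℤ × ℤ → Prop) : ℕ → Finset (ℤ × ℤ) → ℤ × ℤ → Prop
  | 0, T, c => occ c ∧ c ∉ T
  | n + 1, T, c => occ c ∧ c ∉ T ∧ ∃ d, HasPath occ n (insert c T) (kingMove c d)

lemma SubIndep.measure_hasPath_le {Ω : Type*} [MeasurableSpace Ω] {P : Measure Ω}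
    {A : ℤ × ℤ → Set Ω} {q : ℝ≥0∞} (h : SubIndep P A q) (n : ℕ) :
    ∀ (T : Finset (ℤ × ℤ)) (c : ℤ × ℤ),
      P ((⋂ t ∈ T, A t) ∩ {ω | HasPath (fun x => ω ∈ A x) n T c}) ≤
        9 ^ n * q ^ (T.card + n + 1) := by
  induction n with
  | zero =>
    intro T c
    by_cases hc : c ∈ T
    · simp [HasPath, hc]
    refine (measure_mono ?_).trans ((h (insert c T)).trans_eq ?_)
    · rintro ω ⟨h1, h2, -⟩
      simp only [Finset.mem_insert, Set.mem_iInter] at *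
      rintro x (rfl | hx)
      · exact h2
      · exact h1 x hx
    · simp [Finset.card_insert_of_notMem hc]
  | succ n ih =>
    intro T c
    by_cases hc : c ∈ T
    · simp [HasPath, hc]
    calc P ((⋂ t ∈ T, A t) ∩ {ω | HasPath (fun x => ω ∈ A x) (n + 1) T c})
        ≤ P (⋃ d, (⋂ t ∈ insert c T, A t) ∩
            {ω | HasPath (fun x => ω ∈ A x) n (insert c T) (kingMove c d)}) := by
          refine measure_mono ?_
          rintro ω ⟨h1, h2, -, d, hd⟩
          refine Set.mem_iUnion.2 ⟨d, ?_, hd⟩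
          simp only [Finset.mem_insert, Set.mem_iInter] at *
          rintro x (rfl | hx)
          · exact h2
          · exact h1 x hx
      _ ≤ ∑ d : Fin 3 × Fin 3, 9 ^ n * q ^ ((insert c T).card + n + 1) :=
          (measure_iUnion_fintype_le _ _).trans (Finset.sum_le_sum fun d _ => ih _ _)
      _ = 9 ^ (n + 1) * q ^ (T.card + (n + 1) + 1) := by
          rw [Finset.card_insert_of_notMem hc]
          simp only [Finset.sum_const, Finset.card_univ, Fintype.card_prod, Fintype.card_fin,
            nsmul_eq_mul]
          push_cast
          rw [show T.card + 1 + n + 1 = T.card + (n + 1) + 1 by omega]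
          ring

lemma SubIndep.measure_forall_hasPath {Ω : Type*} [MeasurableSpace Ω] {P : Measure Ω}
    {A : ℤ × ℤ → Set Ω} {q : ℝ≥0∞} (h : SubIndep P A q) (hq : 9 * q ≤ 2⁻¹) :
    P {ω | ∃ c, ∀ n, HasPath (fun x => ω ∈ A x) n ∅ c} = 0 := by
  rw [Set.ofPred_exists]
  refine measure_iUnion_null fun c => ?_
  have hq1 : q ≤ 1 := by
    calc q ≤ 9 * q := le_mul_of_one_le_left (by simp) (by norm_num)
      _ ≤ 2⁻¹ := hq
      _ ≤ 1 := by simp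
  have hle : ∀ n : ℕ, P {ω | ∀ n, HasPath (fun x => ω ∈ A x) n ∅ c} ≤ 2⁻¹ ^ n := by
    intro n
    calc P {ω | ∀ n, HasPath (fun x => ω ∈ A x) n ∅ c}
        ≤ P ((⋂ t ∈ (∅ : Finset (ℤ × ℤ)), A t) ∩ {ω | HasPath (fun x => ω ∈ A x) n ∅ c}) :=
          measure_mono fun ω hω => ⟨by simp, hω n⟩
      _ ≤ 9 ^ n * q ^ (n + 1) := by simpa using h.measure_hasPath_le n ∅ c
      _ = (9 * q) ^ n * q := by ring
      _ ≤ 2⁻¹ ^ n * 1 := by gcongr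
      _ = 2⁻¹ ^ n := mul_one _
  refine le_antisymm (ge_of_tendsto' (ENNReal.tendsto_pow_atTop_nhds_zero_of_lt_one ?_) hle)
    bot_le
  simp [ENNReal.inv_lt_one]

/-- Two sites are equal or adjacent, possibly along a diagonal. -/
def KingNbr (x y : ℤ × ℤ) : Prop := (x.1 - y.1).natAbs ≤ 1 ∧ (x.2 - y.2).natAbs ≤ 1

lemma KingNbr.exists_kingMove {x y : ℤ × ℤ} (h : KingNbr x y) : ∃ d, kingMove x d = y := by
  obtain ⟨h1, h2⟩ := h
  refine ⟨(⟨(y.1 - x.1 + 1).toNat, by omega⟩, ⟨(y.2 - x.2 + 1).toNat, by omega⟩), ?_⟩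
  ext <;> simp only [kingMove] <;> omega

/-- A path leaves its starting point for the last time. -/
lemma exists_last_exit {α : Type*} {R : α → α → Prop} {c y : α}
    (h : Relation.ReflTransGen R c y) (hne : y ≠ c) :
    ∃ c', R c c' ∧ Relation.ReflTransGen (fun a b => R a b ∧ a ≠ c ∧ b ≠ c) c' y := by
  induction h with
  | refl => exact absurd rfl hne
  | @tail b y _ hby ih =>
    by_cases hb : b = c
    · subst hb
      exact ⟨y, hby, .refl⟩
    · obtain ⟨c', h1, h2⟩ := ih hb
      exact ⟨c', h1, h2.tail ⟨hby, hb, hne⟩⟩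

lemma hasPath_of_far {occ : ℤ × ℤ → Prop} (n : ℕ) :
    ∀ (T : Finset (ℤ × ℤ)) (c y : ℤ × ℤ), occ c → c ∉ T →
      Relation.ReflTransGen
        (fun a b => (occ a ∧ a ∉ T) ∧ (occ b ∧ b ∉ T) ∧ KingNbr a b) c y →
      (n ≤ (y.1 - c.1).natAbs ∨ n ≤ (y.2 - c.2).natAbs) → HasPath occ n T c := by
  induction n with
  | zero => exact fun T c y hc hT _ _ => ⟨hc, hT⟩
  | succ n ih =>
    intro T c y hc hT hpath hfar
    have hne : y ≠ c := by
      rintro rfl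
      simp at hfar
    obtain ⟨c', ⟨-, h2, h3⟩, h4⟩ := exists_last_exit hpath hne
    obtain ⟨d, rfl⟩ := h3.exists_kingMove
    refine ⟨hc, hT, d, ?_⟩
    have hne' : kingMove c d ≠ c := by
      rcases h4.cases_head with h | ⟨z, hz, -⟩
      · exact h ▸ hne
      · exact hz.2.1
    refine ih _ _ y h2.1 (by simp [hne', h2.2]) ?_ ?_
    · refine Relation.ReflTransGen.mono (fun a b hab => ?_) _ _ h4
      obtain ⟨⟨⟨ha, haT⟩, ⟨hb, hbT⟩, hk⟩, hac, hbc⟩ := hab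
      exact ⟨⟨ha, by simp [hac, haT]⟩, ⟨hb, by simp [hbc, hbT]⟩, hk⟩
    · obtain ⟨h5, h6⟩ := h3
      omega

/-- In a preconnected set, any two points are joined by a chain with small steps. -/
lemma IsPreconnected.exists_chain {α : Type*} [PseudoMetricSpace α] {C : Set α}
    (hC : IsPreconnected C) {ε : ℝ} (hε : 0 < ε) {x y : α} (hx : x ∈ C) (hy : y ∈ C) :
    Relation.ReflTransGen (fun u v => u ∈ C ∧ v ∈ C ∧ dist u v < ε) x y := by
  let R : α → α → Prop := fun u v => u ∈ C ∧ v ∈ C ∧ dist u v < ε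
  by_contra hxy
  let U : Set α := ⋃ z ∈ {z | z ∈ C ∧ Relation.ReflTransGen R x z}, ball z (ε / 2)
  let V : Set α := ⋃ z ∈ {z | z ∈ C ∧ ¬ Relation.ReflTransGen R x z}, ball z (ε / 2)
  have hU : IsOpen U := isOpen_biUnion fun _ _ => isOpen_ball
  have hV : IsOpen V := isOpen_biUnion fun _ _ => isOpen_ball
  have hUV : C ⊆ U ∪ V := by
    intro z hz
    by_cases h : Relation.ReflTransGen R x z
    · exact .inl (Set.mem_biUnion (⟨hz, h⟩ : z ∈ {z | _ ∧ _}) (mem_ball_self (by positivity)))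
    · exact .inr (Set.mem_biUnion (⟨hz, h⟩ : z ∈ {z | _ ∧ _}) (mem_ball_self (by positivity)))
  obtain ⟨w, -, hwU, hwV⟩ := hC U V hU hV hUV
    ⟨x, hx, Set.mem_biUnion (⟨hx, .refl⟩ : x ∈ {z | _ ∧ _}) (mem_ball_self (by positivity))⟩
    ⟨y, hy, Set.mem_biUnion (⟨hy, hxy⟩ : y ∈ {z | _ ∧ _}) (mem_ball_self (by positivity))⟩
  simp only [U, V, Set.mem_iUnion, mem_ball, Set.mem_ofPred_eq, exists_prop] at hwU hwV
  obtain ⟨u, ⟨huC, hu⟩, hwu⟩ := hwU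
  obtain ⟨v, ⟨hvC, hv⟩, hwv⟩ := hwV
  refine hv (hu.tail ⟨huC, hvC, ?_⟩)
  calc dist u v ≤ dist w u + dist w v := dist_triangle_left _ _ _
    _ < ε := by linarith

lemma kingNbr_cellIndex {s : ℝ} (hs : 0 < s) {x y : E2} (h : dist x y ≤ s) :
    KingNbr (cellIndex s x) (cellIndex s y) := by
  have key : ∀ a b : ℝ, |a - b| ≤ s → (⌊a / s⌋ - ⌊b / s⌋).natAbs ≤ 1 := by
    intro a b hab
    obtain ⟨h1, h2⟩ := abs_le.1 hab
    have ha : a / s ≤ b / s + 1 := by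
      rw [div_add_one hs.ne']
      gcongr
      linarith
    have hb : b / s ≤ a / s + 1 := by
      rw [div_add_one hs.ne']
      gcongr
      linarith
    have ha' := Int.floor_le_floor ha
    have hb' := Int.floor_le_floor hb
    rw [Int.floor_add_one] at ha' hb'
    omega
  have hi : ∀ i, |x i - y i| ≤ s := fun i =>
    (abs_apply_le_norm (x - y) i).trans ((dist_eq_norm x y).symm.trans_le h)
  exact ⟨key _ _ (hi 0), key _ _ (hi 1)⟩

lemma Percolates.exists_hasPath {μ : Measure E2} {s r : ℝ} (hs : 0 < s) (hr : 4 * r ≤ s)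
    (h : Percolates (BooleanModel μ r)) :
    ∃ c, ∀ n, HasPath (fun c => μ (cell s c) ≠ 0) n ∅ c := by
  obtain ⟨C, hCS, hC, hunb⟩ := h
  have hatom : ∀ z ∈ C, ∃ x, μ {x} ≠ 0 ∧ dist z x ≤ r := by
    intro z hz
    simpa [BooleanModel, atomsOf] using hCS hz
  choose! p hpμ hp using hatom
  obtain ⟨z₀, hz₀⟩ := hC.nonempty
  have hr0 : 0 ≤ r := dist_nonneg.trans (hp z₀ hz₀)
  have hocc : ∀ z ∈ C, μ (cell s (cellIndex s (p z))) ≠ 0 := fun z hz h0 =>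
    hpμ z hz (measure_mono_null (Set.singleton_subset_iff.2
      (show p z ∈ cell s (cellIndex s (p z)) from rfl)) h0)
  refine ⟨cellIndex s (p z₀), fun n => ?_⟩
  obtain ⟨z, hz, hfar⟩ : ∃ z ∈ C, 3 * ((n + 1) * s) + 2 * r < dist z z₀ := by
    by_contra! hcon
    exact hunb (isBounded_closedBall.subset fun z hz => mem_closedBall.2 (hcon z hz))
  refine hasPath_of_far n ∅ _ (cellIndex s (p z)) (hocc _ hz₀) (by simp) ?_ ?_
  · refine (hC.isPreconnected.exists_chain (half_pos hs) hz₀ hz).lift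
      (fun z => cellIndex s (p z)) ?_
    rintro u v ⟨hu, hv, huv⟩
    refine ⟨⟨hocc u hu, by simp⟩, ⟨hocc v hv, by simp⟩, kingNbr_cellIndex hs ?_⟩
    have h1 := hp u hu
    have h2 := hp v hv
    rw [dist_comm] at h1
    linarith [dist_triangle4 (p u) u v (p v)]
  · by_contra! hcon
    have h1 := hp z hz
    have h2 := hp z₀ hz₀
    rw [dist_comm] at h2
    have h3 := dist_triangle4 z (p z) (p z₀) z₀
    have hd : 3 * ((n + 1) * s) < dist (p z) (p z₀) := by linarith
    refine hd.not_ge (dist_lt_of_forall fun i => ?_)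
    have key : ∀ a b : ℝ, (⌊a / s⌋ - ⌊b / s⌋).natAbs < n → |a - b| < 2 * ((n + 1) * s) := by
      intro a b hab
      have h4 : |a / s - b / s| < n + 1 := by
        have h5 : ⌊a / s⌋ - ⌊b / s⌋ < n ∧ ⌊b / s⌋ - ⌊a / s⌋ < n := by omega
        have h6 : (⌊a / s⌋ : ℝ) - ⌊b / s⌋ < n ∧ (⌊b / s⌋ : ℝ) - ⌊a / s⌋ < n := by
          exact_mod_cast h5
        have h7 := Int.floor_le (a / s)
        have h8 := Int.lt_floor_add_one (a / s)
        have h9 := Int.floor_le (b / s)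
        have h10 := Int.lt_floor_add_one (b / s)
        rw [abs_lt]
        constructor <;> linarith [h6.1, h6.2]
      rw [← sub_div, abs_div, abs_of_pos hs, div_lt_iff₀ hs] at h4
      have : (0 : ℝ) < (n + 1) * s := by positivity
      linarith
    fin_cases i
    · exact key _ _ hcon.1
    · exact key _ _ hcon.2

lemma SubIndep.measure_percolates_eq_zero {Ω : Type*} [MeasurableSpace Ω] {P : Measure Ω}
    {Φ : Ω → Measure E2} {s r : ℝ} {q : ℝ≥0∞} (hs : 0 < s) (hr : 4 * r ≤ s) (hq : 9 * q ≤ 2⁻¹)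
    (h : SubIndep P (fun c => {ω | Φ ω (cell s c) ≠ 0}) q) :
    P {ω | Percolates (BooleanModel (Φ ω) r)} = 0 :=
  measure_mono_null (fun _ hω => hω.exists_hasPath hs hr) (h.measure_forall_hasPath hq)

/-! ### Integer-valued measures -/

/-- A measure on the plane that takes finite integer values on bounded Borel sets. -/
def IsIntMeasure (μ : Measure E2) : Prop :=
  ∀ B : Set E2, MeasurableSet B → Bornology.IsBounded B → ∃ n : ℕ, μ B = (n : ℝ≥0∞)

lemma exists_natCast_eq_tsum {ι : Type*} {f : ι → ℝ≥0∞} (hf : ∀ i, ∃ n : ℕ, f i = n)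
    (h : ∑' i, f i ≠ ∞) : ∃ n : ℕ, ∑' i, f i = n := by
  classical
  have hfin := ENNReal.finite_const_le_of_tsum_ne_top h one_ne_zero
  choose m hm using hf
  refine ⟨∑ i ∈ hfin.toFinset, m i, ?_⟩
  rw [tsum_eq_sum (s := hfin.toFinset)]
  · simp [hm]
  · intro i hi
    simp only [Set.Finite.mem_toFinset, Set.mem_ofPred_eq, not_le, hm] at hi
    rw [hm]
    have : m i < 1 := by exact_mod_cast hi
    simp [Nat.lt_one_iff.mp this]

lemma IsIntMeasure.exists_atom {μ : Measure E2} (h : IsIntMeasure μ) {B : Set E2}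
    (h0 : μ B ≠ 0) : ∃ x ∈ B, μ {x} ≠ 0 := by
  by_contra! hx
  refine h0 (measure_null_of_locally_null B fun x hxB => ?_)
  have hcl : ∀ r : ℝ, ∃ n : ℕ, μ (closedBall x r) = n := fun r =>
    h _ measurableSet_closedBall isBounded_closedBall
  have ht := tendsto_measure_biInter_gt (μ := μ) (s := fun r : ℝ => closedBall x r) (a := 0)
    (fun r _ => measurableSet_closedBall.nullMeasurableSet)
    (fun i j _ hij => closedBall_subset_closedBall hij)
    ⟨1, one_pos, by obtain ⟨n, hn⟩ := hcl 1; simp [hn]⟩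
  have hinter : ⋂ r : ℝ, ⋂ (_ : r > 0), closedBall x r = {x} := by
    ext y
    simp only [Set.mem_iInter, mem_closedBall, Set.mem_singleton_iff]
    refine ⟨fun hy => dist_le_zero.mp (le_of_forall_pos_le_add fun ε hε => ?_), ?_⟩
    · simpa using hy ε hε
    · rintro rfl r hr
      simpa using hr.le
  rw [hinter, hx x hxB] at ht
  have hev := ht.eventually (gt_mem_nhds (zero_lt_one (α := ℝ≥0∞)))
  obtain ⟨r, hr1, hr0⟩ := (hev.and self_mem_nhdsWithin).exists
  refine ⟨closedBall x r, mem_nhdsWithin_of_mem_nhds (closedBall_mem_nhds x hr0), ?_⟩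
  obtain ⟨n, hn⟩ := hcl r
  have hr1' : μ (closedBall x r) < 1 := hr1
  rw [hn] at hr1' ⊢
  have : n < 1 := by exact_mod_cast hr1'
  simp [Nat.lt_one_iff.mp this]

/-- A countable algebra generating the Borel sets of the plane. -/
def countableAlgebra : Set (Set E2) :=
  generateSetAlgebra (MeasurableSpace.countableGeneratingSet E2)

lemma eq_generateFrom_countableAlgebra :
    (inferInstance : MeasurableSpace E2) = MeasurableSpace.generateFrom countableAlgebra := by
  rw [countableAlgebra, generateFrom_generateSetAlgebra_eq,
    MeasurableSpace.generateFrom_countableGeneratingSet]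

lemma measurableSet_of_mem_countableAlgebra {A : Set E2} (hA : A ∈ countableAlgebra) :
    MeasurableSet A := by
  have h := MeasurableSpace.measurableSet_generateFrom hA
  rw [← eq_generateFrom_countableAlgebra] at h
  exact h

lemma isIntMeasure_iff_forall_countableAlgebra {μ : Measure E2} :
    IsIntMeasure μ ↔
      ∀ n : ℕ, ∀ A ∈ countableAlgebra, ∃ m : ℕ, μ (A ∩ ball 0 n) = (m : ℝ≥0∞) := by
  refine ⟨fun h n A hA => h _ ((measurableSet_of_mem_countableAlgebra hA).inter measurableSet_ball)
    (isBounded_ball.subset Set.inter_subset_right), fun h B hB hbd => ?_⟩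
  obtain ⟨r, hr⟩ := hbd.subset_ball 0
  obtain ⟨n, hn⟩ := exists_nat_ge r
  have hBn : B ∩ ball 0 n = B := Set.inter_eq_left.mpr (hr.trans (ball_subset_ball hn))
  rw [← hBn]
  have halg : IsSetAlgebra countableAlgebra := isSetAlgebra_generateSetAlgebra
  obtain ⟨N, hN⟩ := h n _ halg.univ_mem
  rw [Set.univ_inter] at hN
  clear hBn hr hbd
  induction B, hB using MeasurableSpace.induction_on_inter eq_generateFrom_countableAlgebra
    (fun A hA B hB _ => halg.inter_mem hA hB) with
  | empty => exact ⟨0, by simp⟩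
  | basic A hA => exact h n A hA
  | compl A hA ih =>
    obtain ⟨m, hm⟩ := ih
    refine ⟨N - m, ?_⟩
    have : Aᶜ ∩ ball 0 (n : ℝ) = ball 0 (n : ℝ) \ (A ∩ ball 0 n) := by
      ext x; simp; tauto
    rw [this, measure_sdiff Set.inter_subset_right
      (hA.inter measurableSet_ball).nullMeasurableSet (by simp [hm]), hN, hm]
    norm_cast
  | iUnion f hd hf ih =>
    rw [Set.iUnion_inter]
    have hU : μ (⋃ i, f i ∩ ball 0 (n : ℝ)) = ∑' i, μ (f i ∩ ball 0 (n : ℝ)) :=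
      measure_iUnion (fun i j hij => (hd hij).mono Set.inter_subset_left Set.inter_subset_left)
        (fun i => (hf i).inter measurableSet_ball)
    rw [hU]
    refine exists_natCast_eq_tsum ih ?_
    rw [← hU]
    refine ne_top_of_le_ne_top (b := μ (ball 0 (n : ℝ))) (by simp [hN])
      (measure_mono (Set.iUnion_subset fun i => Set.inter_subset_right))

lemma measurableSet_isIntMeasure : MeasurableSet {μ : Measure E2 | IsIntMeasure μ} := by
  have hc : countableAlgebra.Countable :=
    countable_generateSetAlgebra (MeasurableSpace.countable_countableGeneratingSet (α := E2))
  simp only [isIntMeasure_iff_forall_countableAlgebra, Set.ofPred_forall]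
  refine MeasurableSet.iInter fun n => MeasurableSet.biInter hc fun A hA => ?_
  have hset : {μ : Measure E2 | ∃ m : ℕ, μ (A ∩ ball 0 n) = (m : ℝ≥0∞)}
      = ⋃ m : ℕ, (fun μ : Measure E2 => μ (A ∩ ball 0 n)) ⁻¹' {(m : ℝ≥0∞)} := by
    ext; simp
  rw [hset]
  exact MeasurableSet.iUnion fun m => Measure.measurable_coe
    ((measurableSet_of_mem_countableAlgebra hA).inter measurableSet_ball) (measurableSet_singleton _)

lemma IsIntMeasure.add {μ ν : Measure E2} (hμ : IsIntMeasure μ) (hν : IsIntMeasure ν) :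
    IsIntMeasure (μ + ν) := by
  intro B hB hb
  obtain ⟨m, hm⟩ := hμ B hB hb
  obtain ⟨n, hn⟩ := hν B hB hb
  exact ⟨m + n, by simp [hm, hn]⟩

/-! ### Convolution powers and compound Poisson laws -/

section ConvPow

variable {M : Type*} [AddMonoid M] [MeasurableSpace M]

/-- Convolution powers of a measure on an additive monoid. -/
def convPow (κ : Measure M) : ℕ → Measure M
  | 0 => Measure.dirac 0
  | n + 1 => (convPow κ n).conv κ

/-- The mixture of the convolution powers of `κ` with weights `w`. -/
def mixPow (w : ℕ → ℝ≥0∞) (κ : Measure M) : Measure M :=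
  Measure.sum fun n => w n • convPow κ n

lemma mixPow_apply {w : ℕ → ℝ≥0∞} {κ : Measure M} {s : Set M} (hs : MeasurableSet s) :
    mixPow w κ s = ∑' n, w n * convPow κ n s := by
  simp [mixPow, Measure.sum_apply _ hs]

lemma ae_mixPow {w : ℕ → ℝ≥0∞} {κ : Measure M} {p : M → Prop}
    (h : ∀ n, ∀ᵐ x ∂convPow κ n, p x) : ∀ᵐ x ∂mixPow w κ, p x :=
  Measure.ae_sum_iff.mpr fun n => Measure.ae_smul_measure (h n) _

variable [MeasurableAdd₂ M] {κ : Measure M}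

lemma ae_convPow {p : M → Prop} (hp : MeasurableSet {x | p x}) (h0 : p 0)
    (hadd : ∀ x y, p x → p y → p (x + y)) (hκ : ∀ᵐ x ∂κ, p x) (n : ℕ) :
    ∀ᵐ x ∂convPow κ n, p x := by
  induction n with
  | zero => exact (ae_dirac_iff hp).mpr h0
  | succ n ih =>
    refine (ae_map_iff (by fun_prop) hp).mpr ?_
    filter_upwards [Measure.quasiMeasurePreserving_fst.ae ih,
      Measure.quasiMeasurePreserving_snd.ae hκ] with x hx hy using hadd _ _ hx hy

variable [IsProbabilityMeasure κ]

instance isProbabilityMeasure_convPow (n : ℕ) : IsProbabilityMeasure (convPow κ n) := by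
  induction n with
  | zero => unfold convPow; infer_instance
  | succ n ih => unfold convPow; infer_instance

lemma isProbabilityMeasure_mixPow {w : ℕ → ℝ≥0∞} (hw : ∑' n, w n = 1) :
    IsProbabilityMeasure (mixPow w κ) :=
  ⟨by simp [mixPow_apply MeasurableSet.univ, hw]⟩

lemma convPow_one : convPow κ 1 = κ := by
  simp [convPow]

lemma convPow_apply_of_forall_add {s : Set M} (hs : MeasurableSet s) (h0 : (0 : M) ∈ s)
    (hadd : ∀ x y, x + y ∈ s ↔ x ∈ s ∧ y ∈ s) (n : ℕ) : convPow κ n s = κ s ^ n := by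
  induction n with
  | zero => simp [convPow, h0, hs]
  | succ n ih =>
    have hpre : (fun x : M × M => x.1 + x.2) ⁻¹' s = s ×ˢ s := by
      ext x; simp [hadd]
    rw [convPow, Measure.conv, Measure.map_apply (by fun_prop) hs, hpre, Measure.prod_prod, ih,
      pow_succ]

lemma lintegral_convPow_of_add {f : M → ℝ≥0∞} (hf : Measurable f) (h0 : f 0 = 0)
    (hadd : ∀ x y, f (x + y) = f x + f y) (n : ℕ) :
    ∫⁻ x, f x ∂convPow κ n = n * ∫⁻ x, f x ∂κ := by
  induction n with
  | zero => simp [convPow, lintegral_dirac' _ hf, h0]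
  | succ n ih =>
    rw [convPow, Measure.lintegral_conv hf]
    simp only [hadd]
    simp_rw [lintegral_add_left (measurable_const)]
    rw [lintegral_add_left (by fun_prop)]
    simp [ih, add_mul]

lemma integral_convPow_of_mul {f : M → ℂ} (hf : Measurable f) {p : M → Prop}
    (hp : MeasurableSet {x | p x}) (hp0 : p 0) (hpadd : ∀ x y, p x → p y → p (x + y))
    (hκ : ∀ᵐ x ∂κ, p x) (h0 : f 0 = 1)
    (hmul : ∀ x y, p x → p y → f (x + y) = f x * f y) (n : ℕ) :
    ∫ x, f x ∂convPow κ n = (∫ x, f x ∂κ) ^ n := by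
  induction n with
  | zero => simp [convPow, integral_dirac' _ _ hf.stronglyMeasurable, h0]
  | succ n ih =>
    rw [convPow, Measure.conv, integral_map (by fun_prop) hf.aestronglyMeasurable]
    have hae : ∀ᵐ x ∂(convPow κ n).prod κ, f (x.1 + x.2) = f x.1 * f x.2 := by
      filter_upwards [Measure.quasiMeasurePreserving_fst.ae (ae_convPow hp hp0 hpadd hκ n),
        Measure.quasiMeasurePreserving_snd.ae hκ] with x hx hy using hmul _ _ hx hy
    rw [integral_congr_ae hae, integral_prod_mul, ih, pow_succ]

lemma lintegral_mixPow_of_add {w : ℕ → ℝ≥0∞} {f : M → ℝ≥0∞} (hf : Measurable f) (h0 : f 0 = 0)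
    (hadd : ∀ x y, f (x + y) = f x + f y) :
    ∫⁻ x, f x ∂mixPow w κ = (∑' n, w n * n) * ∫⁻ x, f x ∂κ := by
  rw [mixPow, lintegral_sum_measure, ← ENNReal.tsum_mul_right]
  simp [lintegral_convPow_of_add hf h0 hadd, mul_assoc]

end ConvPow

/-- The Poisson mixture of convolution powers: the compound Poisson law. -/
def compoundPoisson {M : Type*} [AddMonoid M] [MeasurableSpace M] (a : ℝ) (κ : Measure M) :
    Measure M :=
  mixPow (fun n => ENNReal.ofReal (Real.exp (-a) * a ^ n / n.factorial)) κ

lemma hasSum_poisson_weight (a : ℝ) :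
    HasSum (fun n : ℕ => Real.exp (-a) * a ^ n / n.factorial) 1 := by
  have h := (NormedSpace.expSeries_div_hasSum_exp a).mul_left (Real.exp (-a))
  rw [← Real.exp_eq_exp_ℝ, ← Real.exp_add, neg_add_cancel, Real.exp_zero] at h
  simpa [mul_div_assoc] using h

lemma tsum_poisson_weight {a : ℝ} (ha : 0 ≤ a) :
    ∑' n : ℕ, ENNReal.ofReal (Real.exp (-a) * a ^ n / n.factorial) = 1 := by
  rw [← ENNReal.ofReal_tsum_of_nonneg (fun n => by positivity) (hasSum_poisson_weight a).summable,
    (hasSum_poisson_weight a).tsum_eq, ENNReal.ofReal_one]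

lemma hasSum_poisson_weight_mul (a : ℝ) :
    HasSum (fun n : ℕ => Real.exp (-a) * a ^ n / n.factorial * n) a := by
  refine (hasSum_nat_add_iff' 1).mp ?_
  have h := (hasSum_poisson_weight a).mul_left a
  simp only [Finset.range_one, Finset.sum_singleton, Nat.cast_zero, mul_zero, sub_zero]
  rw [mul_one] at h
  convert! h using 2 with n
  rw [Nat.factorial_succ]
  push_cast
  have : (n.factorial : ℝ) ≠ 0 := by positivity
  field_simp
  ring

lemma tsum_poisson_weight_mul {a : ℝ} (ha : 0 ≤ a) :
    ∑' n : ℕ, ENNReal.ofReal (Real.exp (-a) * a ^ n / n.factorial) * n = ENNReal.ofReal a := by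
  rw [← (hasSum_poisson_weight_mul a).tsum_eq,
    ENNReal.ofReal_tsum_of_nonneg (fun n => by positivity) (hasSum_poisson_weight_mul a).summable]
  congr 1 with n
  rw [ENNReal.ofReal_mul (by positivity), ENNReal.ofReal_natCast,
    (hasSum_poisson_weight_mul a).tsum_eq]

section CompoundPoisson

variable {M : Type*} [AddMonoid M] [MeasurableSpace M] [MeasurableAdd₂ M] {κ : Measure M}
  [IsProbabilityMeasure κ]

lemma isProbabilityMeasure_compoundPoisson {a : ℝ} (ha : 0 ≤ a) :
    IsProbabilityMeasure (compoundPoisson a κ) :=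
  isProbabilityMeasure_mixPow (tsum_poisson_weight ha)

lemma integral_compoundPoisson_of_mul {a : ℝ} (ha : 0 ≤ a) {f : M → ℂ} (hf : Measurable f)
    (hbound : ∀ x, ‖f x‖ ≤ 1) {p : M → Prop}
    (hp : MeasurableSet {x | p x}) (hp0 : p 0) (hpadd : ∀ x y, p x → p y → p (x + y))
    (hκ : ∀ᵐ x ∂κ, p x) (h0 : f 0 = 1)
    (hmul : ∀ x y, p x → p y → f (x + y) = f x * f y) :
    ∫ x, f x ∂compoundPoisson a κ = Complex.exp (a * ((∫ x, f x ∂κ) - 1)) := by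
  have := isProbabilityMeasure_compoundPoisson (κ := κ) ha
  have hInt : Integrable f (compoundPoisson a κ) :=
    Integrable.of_bound hf.aestronglyMeasurable 1 (Filter.Eventually.of_forall hbound)
  rw [compoundPoisson, mixPow, integral_sum_measure hInt]
  simp_rw [integral_smul_measure, integral_convPow_of_mul hf hp hp0 hpadd hκ h0 hmul]
  set z := ∫ x, f x ∂κ
  have h := (NormedSpace.expSeries_div_hasSum_exp ((a : ℂ) * z)).mul_left (Complex.exp (-a))
  rw [← Complex.exp_eq_exp_ℂ, ← Complex.exp_add] at h
  rw [show (a : ℂ) * (z - 1) = -a + a * z by ring, ← h.tsum_eq]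
  congr 1 with n
  rw [ENNReal.toReal_ofReal (by positivity), Complex.real_smul]
  push_cast
  ring

end CompoundPoisson

/-! ### The Poisson process on the plane -/

section PoissonProcess

open ProbabilityTheory

lemma isIntMeasure_zero : IsIntMeasure 0 := fun _ _ _ => ⟨0, by simp⟩

lemma isIntMeasure_dirac (x : E2) : IsIntMeasure (Measure.dirac x) := by
  intro B hB _
  by_cases hx : x ∈ B
  · exact ⟨1, by simp [hB, hx]⟩
  · exact ⟨0, by simp [hB, hx]⟩

/-- Glue together a family of measures along the unit cells. -/
def superpose (ω : ℤ × ℤ → Measure E2) : Measure E2 :=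
  Measure.sum fun c => (ω c).restrict (cell 1 c)

lemma superpose_apply (ω : ℤ × ℤ → Measure E2) {B : Set E2} (hB : MeasurableSet B) :
    superpose ω B = ∑' c, ω c (B ∩ cell 1 c) := by
  simp [superpose, Measure.sum_apply _ hB, Measure.restrict_apply hB]

lemma superpose_apply_finset (ω : ℤ × ℤ → Measure E2) {B : Set E2} (hB : MeasurableSet B)
    {F : Finset (ℤ × ℤ)} (hF : ∀ c ∉ F, B ∩ cell 1 c = ∅) :
    superpose ω B = ∑ c ∈ F, ω c (B ∩ cell 1 c) := by
  rw [superpose_apply ω hB, tsum_eq_sum]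
  intro c hc
  simp [hF c hc]

lemma superpose_const (μ : Measure E2) : superpose (fun _ => μ) = μ := by
  rw [superpose, ← Measure.restrict_iUnion (pairwise_disjoint_cell 1)
    (fun c => measurableSet_cell 1 c), iUnion_cell, Measure.restrict_univ]

lemma measurable_superpose : Measurable superpose := by
  refine Measure.measurable_of_measurable_coe _ fun B hB => ?_
  simp_rw [superpose_apply _ hB]
  exact Measurable.tsum fun c =>
    (Measure.measurable_coe (hB.inter (measurableSet_cell 1 c))).comp (measurable_pi_apply c)

lemma isIntMeasure_superpose {ω : ℤ × ℤ → Measure E2} (h : ∀ c, IsIntMeasure (ω c)) :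
    IsIntMeasure (superpose ω) := by
  intro B hB hb
  obtain ⟨F, hF⟩ := exists_finset_cell one_pos hb
  choose m hm using fun c => h c (B ∩ cell 1 c) (hB.inter (measurableSet_cell 1 c))
    (hb.subset Set.inter_subset_left)
  exact ⟨∑ c ∈ F, m c, by simp [superpose_apply_finset ω hB hF, hm]⟩

/-- The law of a single uniform point in the cell `c`. -/
def uniformPoint (c : ℤ × ℤ) : Measure (Measure E2) :=
  (volume.restrict (cell 1 c)).map Measure.dirac

instance isProbabilityMeasure_restrict_cell (c : ℤ × ℤ) :
    IsProbabilityMeasure ((volume : Measure E2).restrict (cell 1 c)) :=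
  ⟨by simp [volume_cell one_pos]⟩

instance isProbabilityMeasure_uniformPoint (c : ℤ × ℤ) :
    IsProbabilityMeasure (uniformPoint c) :=
  Measure.isProbabilityMeasure_map Measure.measurable_dirac.aemeasurable

lemma ae_isIntMeasure_uniformPoint (c : ℤ × ℤ) : ∀ᵐ μ ∂uniformPoint c, IsIntMeasure μ :=
  (ae_map_iff Measure.measurable_dirac.aemeasurable measurableSet_isIntMeasure).mpr
    (Filter.Eventually.of_forall isIntMeasure_dirac)

/-- The law of the homogeneous Poisson process of intensity `a` on the plane. -/
def poissonLaw (a : ℝ) : Measure (Measure E2) :=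
  (Measure.infinitePi fun c => compoundPoisson a (uniformPoint c)).map superpose

variable {a : ℝ}

lemma isProbabilityMeasure_poissonLaw (ha : 0 ≤ a) : IsProbabilityMeasure (poissonLaw a) := by
  have := fun c => isProbabilityMeasure_compoundPoisson (κ := uniformPoint c) ha
  exact Measure.isProbabilityMeasure_map measurable_superpose.aemeasurable

lemma ae_isIntMeasure_infinitePi (ha : 0 ≤ a) :
    ∀ᵐ ω ∂(Measure.infinitePi fun c => compoundPoisson a (uniformPoint c)),
      ∀ c, IsIntMeasure (ω c) := by
  have := fun c => isProbabilityMeasure_compoundPoisson (κ := uniformPoint c) ha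
  refine ae_all_iff.mpr fun c => ?_
  have h : ∀ᵐ μ ∂compoundPoisson a (uniformPoint c), IsIntMeasure μ :=
    ae_mixPow (ae_convPow measurableSet_isIntMeasure isIntMeasure_zero
      (fun _ _ => IsIntMeasure.add) (ae_isIntMeasure_uniformPoint c))
  rw [← Measure.infinitePi_map_eval (fun c => compoundPoisson a (uniformPoint c)) c] at h
  exact ae_of_ae_map (measurable_pi_apply c).aemeasurable h

lemma ae_isIntMeasure_poissonLaw (ha : 0 ≤ a) : ∀ᵐ μ ∂poissonLaw a, IsIntMeasure μ := by
  refine (ae_map_iff measurable_superpose.aemeasurable measurableSet_isIntMeasure).mpr ?_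
  filter_upwards [ae_isIntMeasure_infinitePi ha] with ω hω using isIntMeasure_superpose hω

lemma lintegral_poissonLaw (ha : 0 ≤ a) {B : Set E2} (hB : MeasurableSet B) :
    ∫⁻ μ, μ B ∂poissonLaw a = ENNReal.ofReal a * volume B := by
  have := fun c => isProbabilityMeasure_compoundPoisson (κ := uniformPoint c) ha
  have hBc := fun c => hB.inter (measurableSet_cell 1 c)
  rw [poissonLaw, lintegral_map (Measure.measurable_coe hB) measurable_superpose]
  simp_rw [superpose_apply _ hB]
  rw [lintegral_tsum (f := fun c (ω : ℤ × ℤ → Measure E2) => ω c (B ∩ cell 1 c)) fun c =>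
    ((Measure.measurable_coe (hBc c)).comp (measurable_pi_apply c)).aemeasurable]
  have hc : ∀ c, ∫⁻ ω, ω c (B ∩ cell 1 c)
      ∂(Measure.infinitePi fun c => compoundPoisson a (uniformPoint c))
      = ENNReal.ofReal a * volume (B ∩ cell 1 c) := by
    intro c
    rw [← lintegral_map (f := fun μ : Measure E2 => μ (B ∩ cell 1 c))
      (Measure.measurable_coe (hBc c)) (measurable_pi_apply c), Measure.infinitePi_map_eval,
      compoundPoisson, lintegral_mixPow_of_add (Measure.measurable_coe (hBc c)) (by simp)
      (by simp), tsum_poisson_weight_mul ha, uniformPoint,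
      lintegral_map (Measure.measurable_coe (hBc c)) Measure.measurable_dirac]
    simp_rw [Measure.dirac_apply' _ (hBc c)]
    rw [lintegral_indicator_one (hBc c), Measure.restrict_apply (hBc c), Set.inter_assoc,
      Set.inter_self]
  simp_rw [hc]
  rw [ENNReal.tsum_mul_left, ← superpose_apply _ hB, superpose_const]

/-- The character `exp (i ∑ t_j μ(B_j))` of a point configuration. -/
def phase {k : ℕ} (B : Fin k → Set E2) (t : Fin k → ℝ) (μ : Measure E2) : ℂ :=
  Complex.exp ((∑ j, t j * (μ (B j)).toReal : ℝ) * Complex.I)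

variable {k : ℕ} {B : Fin k → Set E2}

lemma norm_phase (t : Fin k → ℝ) (μ : Measure E2) : ‖phase B t μ‖ = 1 :=
  Complex.norm_exp_ofReal_mul_I _

lemma measurable_phase (hB : ∀ j, MeasurableSet (B j)) (t : Fin k → ℝ) :
    Measurable (phase B t) := by
  unfold phase
  have := fun j => (Measure.measurable_coe (hB j)).ennreal_toReal
  fun_prop

lemma integral_phase_uniformPoint (hB : ∀ j, MeasurableSet (B j))
    (hd : Pairwise (Function.onFun Disjoint B)) (t : Fin k → ℝ) {c : ℤ × ℤ}
    (hc : ∀ j, B j ⊆ cell 1 c) :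
    ∫ μ, phase B t μ ∂uniformPoint c
      = 1 + ∑ j, volume.real (B j) * (Complex.exp (t j * Complex.I) - 1) := by
  rw [uniformPoint, integral_map Measure.measurable_dirac.aemeasurable
    (measurable_phase hB t).aestronglyMeasurable]
  have hpt : ∀ x, phase B t (Measure.dirac x)
      = 1 + ∑ j, (B j).indicator (fun _ => Complex.exp (t j * Complex.I) - 1) x := by
    intro x
    by_cases hx : ∃ j, x ∈ B j
    · obtain ⟨j, hj⟩ := hx
      have hne : ∀ i, i ≠ j → x ∉ B i := fun i hi hxi => (hd hi).ne_of_mem hxi hj rfl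
      have h1 : ∑ i, t i * (Measure.dirac x (B i)).toReal = t j := by
        rw [Finset.sum_eq_single j]
        · simp [hj]
        · intro i _ hi
          simp [hne i hi]
        · simp
      rw [phase, h1, Finset.sum_eq_single j]
      · simp [hj]
      · intro i _ hi
        simp [hne i hi]
      · simp
    · push Not at hx
      simp [phase, hx, hB]
  simp_rw [hpt]
  have hInt : ∀ j, Integrable ((B j).indicator fun _ => Complex.exp (t j * Complex.I) - 1)
      ((volume : Measure E2).restrict (cell 1 c)) := fun j =>
    (integrable_const _).indicator (hB j)
  rw [integral_add (integrable_const _) (integrable_finsetSum _ fun j _ => hInt j),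
    integral_finsetSum _ fun j _ => hInt j]
  simp [integral_indicator_const _ (hB _), measureReal_restrict_apply (hB _),
    Set.inter_eq_left.mpr (hc _)]

lemma integral_phase_compoundPoisson (ha : 0 ≤ a) (hB : ∀ j, MeasurableSet (B j))
    (hb : ∀ j, Bornology.IsBounded (B j))
    (hd : Pairwise (Function.onFun Disjoint B)) (t : Fin k → ℝ) {c : ℤ × ℤ}
    (hc : ∀ j, B j ⊆ cell 1 c) :
    ∫ μ, phase B t μ ∂compoundPoisson a (uniformPoint c)
      = Complex.exp (∑ j, a * volume.real (B j) * (Complex.exp (t j * Complex.I) - 1)) := by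
  rw [integral_compoundPoisson_of_mul ha (measurable_phase hB t)
    (fun μ => (norm_phase t μ).le) measurableSet_isIntMeasure isIntMeasure_zero
    (fun _ _ => IsIntMeasure.add) (ae_isIntMeasure_uniformPoint c) (by simp [phase]),
    integral_phase_uniformPoint hB hd t hc]
  · rw [add_sub_cancel_left, Finset.mul_sum]
    simp_rw [mul_assoc]
  · intro μ ν hμ hν
    rw [phase, phase, phase, ← Complex.exp_add, ← add_mul, ← Complex.ofReal_add,
      ← Finset.sum_add_distrib]
    have h : ∀ j, ((μ + ν) (B j)).toReal = (μ (B j)).toReal + (ν (B j)).toReal := by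
      intro j
      obtain ⟨m, hm⟩ := hμ _ (hB j) (hb j)
      obtain ⟨n, hn⟩ := hν _ (hB j) (hb j)
      rw [Measure.add_apply, ENNReal.toReal_add (by simp [hm]) (by simp [hn])]
    simp_rw [h, mul_add]

lemma integral_phase_poissonLaw (ha : 0 ≤ a) (hB : ∀ j, MeasurableSet (B j))
    (hb : ∀ j, Bornology.IsBounded (B j))
    (hd : Pairwise (Function.onFun Disjoint B)) (t : Fin k → ℝ) :
    ∫ μ, phase B t μ ∂poissonLaw a
      = Complex.exp (∑ j, a * volume.real (B j) * (Complex.exp (t j * Complex.I) - 1)) := by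
  have := fun c => isProbabilityMeasure_compoundPoisson (κ := uniformPoint c) ha
  have hBc := fun j c => (hB j).inter (measurableSet_cell 1 c)
  have hbc : ∀ j c, Bornology.IsBounded (B j ∩ cell 1 c) := fun j c =>
    (hb j).subset Set.inter_subset_left
  obtain ⟨F, hF⟩ := exists_finset_cell one_pos (Bornology.isBounded_iUnion.mpr hb)
  have hF' : ∀ j, ∀ c ∉ F, B j ∩ cell 1 c = ∅ := fun j c hcF =>
    Set.subset_empty_iff.mp ((Set.inter_subset_inter_left _ (Set.subset_iUnion B j)).trans
      (hF c hcF).subset)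
  rw [poissonLaw, integral_map measurable_superpose.aemeasurable
    (measurable_phase hB t).aestronglyMeasurable]
  have hae : ∀ᵐ ω ∂(Measure.infinitePi fun c => compoundPoisson a (uniformPoint c)),
      phase B t (superpose ω) = ∏ c : F, phase (fun j => B j ∩ cell 1 c) t (ω c) := by
    filter_upwards [ae_isIntMeasure_infinitePi ha] with ω hω
    have h : ∀ j, (superpose ω (B j)).toReal = ∑ c ∈ F, (ω c (B j ∩ cell 1 c)).toReal := by
      intro j
      rw [superpose_apply_finset ω (hB j) (hF' j), ENNReal.toReal_sum]
      intro c _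
      obtain ⟨n, hn⟩ := hω c _ (hBc j c) (hbc j c)
      simp [hn]
    rw [Finset.prod_coe_sort F (fun c => phase (fun j => B j ∩ cell 1 c) t (ω c))]
    simp_rw [phase, h]
    rw [← Complex.exp_sum, ← Finset.sum_mul, ← Complex.ofReal_sum, Finset.sum_comm]
    simp_rw [Finset.mul_sum]
  have hind : iIndepFun (fun (c : F) (ω : ℤ × ℤ → Measure E2) => ω c)
      (Measure.infinitePi fun c => compoundPoisson a (uniformPoint c)) :=
    (iIndepFun_infinitePi (X := fun _ μ => μ) (fun _ => measurable_id)).precomp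
      Subtype.val_injective
  rw [integral_congr_ae hae, hind.integral_fun_prod_comp
    (f := fun (c : F) μ => phase (fun j => B j ∩ cell 1 c) t μ)
    (fun c => (measurable_pi_apply _).aemeasurable)
    (fun c => (measurable_phase (fun j => hBc j c) t).aestronglyMeasurable)]
  have hc : ∀ c : F, ∫ ω, phase (fun j => B j ∩ cell 1 c) t (ω c)
      ∂(Measure.infinitePi fun c => compoundPoisson a (uniformPoint c))
      = Complex.exp (∑ j, a * volume.real (B j ∩ cell 1 c)
        * (Complex.exp (t j * Complex.I) - 1)) := by
    intro c
    rw [← integral_map (φ := fun ω : ℤ × ℤ → Measure E2 => ω c)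
      (f := fun μ => phase (fun j => B j ∩ cell 1 c) t μ)
      (measurable_pi_apply _).aemeasurable
      (measurable_phase (fun j => hBc j c) t).aestronglyMeasurable, Measure.infinitePi_map_eval,
      integral_phase_compoundPoisson ha (fun j => hBc j c) (fun j => hbc j c)
      (fun i j hij => (hd hij).mono Set.inter_subset_left Set.inter_subset_left) t
      (fun j => Set.inter_subset_right)]
  simp_rw [hc]
  rw [← Complex.exp_sum, Finset.sum_comm]
  congr 1
  refine Finset.sum_congr rfl fun j _ => ?_
  rw [← Finset.sum_mul, ← Finset.mul_sum, ← Complex.ofReal_sum,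
    Finset.sum_coe_sort F (fun c => volume.real (B j ∩ cell 1 c))]
  congr 3
  have h := superpose_apply_finset (fun _ => volume) (hB j) (hF' j)
  rw [superpose_const] at h
  rw [measureReal_def, h, ENNReal.toReal_sum]
  · rfl
  · intro c _
    exact (hbc j c).measure_lt_top.ne

lemma map_poissonLaw_eq_pi (ha : 0 ≤ a) (hB : ∀ j, MeasurableSet (B j))
    (hb : ∀ j, Bornology.IsBounded (B j)) (hd : Pairwise (Function.onFun Disjoint B)) :
    (poissonLaw a).map (fun μ j => (μ (B j)).toReal)
      = Measure.pi fun j =>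
        (poissonMeasure (a * volume.real (B j)).toNNReal).map (Nat.cast : ℕ → ℝ) := by
  have := isProbabilityMeasure_poissonLaw ha
  have hm : Measurable fun (μ : Measure E2) j => (μ (B j)).toReal :=
    measurable_pi_lambda _ fun j => (Measure.measurable_coe (hB j)).ennreal_toReal
  have := Measure.isProbabilityMeasure_map (μ := poissonLaw a) hm.aemeasurable
  refine charFun_eq_pi_iff.mp fun t => ?_
  simp_rw [charFun_map_cast_poissonMeasure]
  rw [charFun_apply, integral_map (by fun_prop) (by fun_prop),
    integral_map hm.aemeasurable (by fun_prop), ← Complex.exp_sum]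
  have h := integral_phase_poissonLaw ha hB hb hd t
  have hr : ∀ j, ((a * volume.real (B j)).toNNReal : ℂ) = a * volume.real (B j) := by
    intro j
    rw [← Complex.ofReal_mul]
    exact congrArg _ (Real.coe_toNNReal _ (by positivity))
  simp_rw [hr]
  rw [← h]
  simp [phase, PiLp.inner_apply, mul_comm]

lemma poissonLaw_apply (ha : 0 ≤ a) (hB : ∀ j, MeasurableSet (B j))
    (hb : ∀ j, Bornology.IsBounded (B j)) (hd : Pairwise (Function.onFun Disjoint B))
    (n : Fin k → ℕ) :
    poissonLaw a {μ | ∀ j, μ (B j) = (n j : ℝ≥0∞)}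
      = ∏ j, _root_.poissonPMF ((ENNReal.ofReal a • (volume : Measure E2)) (B j)) (n j) := by
  have hm : Measurable fun (μ : Measure E2) j => (μ (B j)).toReal :=
    measurable_pi_lambda _ fun j => (Measure.measurable_coe (hB j)).ennreal_toReal
  have hset : poissonLaw a {μ | ∀ j, μ (B j) = (n j : ℝ≥0∞)}
      = (poissonLaw a).map (fun μ j => (μ (B j)).toReal) {fun j => (n j : ℝ)} := by
    rw [Measure.map_apply hm (measurableSet_singleton _)]
    refine measure_congr ?_
    filter_upwards [ae_isIntMeasure_poissonLaw ha] with μ hμ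
    refine propext ⟨fun h => ?_, fun h j => ?_⟩
    · have h' : ∀ j, μ (B j) = (n j : ℝ≥0∞) := h
      ext j
      simp [h']
    · have h' : (fun j => (μ (B j)).toReal) = fun j => (n j : ℝ) := h
      have hj := congrFun h' j
      obtain ⟨m, hm⟩ := hμ _ (hB j) (hb j)
      simp only [hm, ENNReal.toReal_natCast, Nat.cast_inj] at hj
      rw [hm, hj]
  rw [hset, map_poissonLaw_eq_pi ha hB hb hd, Measure.pi_singleton]
  refine Finset.prod_congr rfl fun j _ => ?_
  rw [Measure.map_apply .of_discrete (measurableSet_singleton _)]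
  have hpre : (Nat.cast : ℕ → ℝ) ⁻¹' {(n j : ℝ)} = {n j} := by ext; simp
  rw [hpre, poissonMeasure_singleton, _root_.poissonPMF]
  have hr : ((ENNReal.ofReal a • (volume : Measure E2)) (B j)).toReal
      = ((a * volume.real (B j)).toNNReal : ℝ) := by
    rw [Real.coe_toNNReal _ (by positivity)]
    simp [ENNReal.toReal_ofReal ha, measureReal_def]
  rw [hr]

lemma poissonLaw_void (ha : 0 ≤ a) {B : Set E2} (hB : MeasurableSet B)
    (hb : Bornology.IsBounded B) :
    poissonLaw a {μ | μ B = 0} = ENNReal.ofReal (Real.exp (-(a * volume.real B))) := by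
  have h := poissonLaw_apply (k := 1) (B := fun _ => B) ha (fun _ => hB) (fun _ => hb)
    (fun i j hij => absurd (Subsingleton.elim i j) hij) (fun _ => 0)
  simpa [_root_.poissonPMF, ENNReal.toReal_ofReal ha, measureReal_def] using h

end PoissonProcess

/-! ### Percolation of superposed Poisson processes -/

section Percolation

lemma measure_percolates_pos {P : Measure (Measure E2)} [IsProbabilityMeasure P]
    (hInt : ∀ᵐ μ ∂P, IsIntMeasure μ) {s r : ℝ} {q : ℝ≥0∞} (hs : 0 < s) (hr : 3 * s ≤ r)
    (hq : 81 * q ≤ 3⁻¹) (h : SubIndep P (fun c => {μ : Measure E2 | μ (cell s c) = 0}) q) :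
    0 < P {μ | Percolates (BooleanModel μ r)} := by
  refine (h.exists_infinite_cluster hq).trans_le (measure_mono_ae ?_)
  filter_upwards [hInt] with μ hμ hcl
  exact percolates_of_cluster hs hr
    (fun c hc => hμ.exists_atom hc) hcl

variable {a : ℝ}

lemma measureReal_biUnion_cell {s : ℝ} (hs : 0 < s) (S : Finset (ℤ × ℤ)) :
    volume.real (⋃ c ∈ S, cell s c) = S.card * s ^ 2 := by
  rw [measureReal_biUnion_finset (fun i _ j _ hij => pairwise_disjoint_cell s hij)
    (fun c _ => measurableSet_cell s c)
    (fun c _ => (Bornology.IsBounded.cell hs c).measure_lt_top.ne)]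
  simp [measureReal_def, volume_cell hs, ENNReal.toReal_ofReal (sq_nonneg s)]

lemma poissonLaw_biInter_void (ha : 0 ≤ a) {s : ℝ} (hs : 0 < s) (S : Finset (ℤ × ℤ)) :
    poissonLaw a (⋂ c ∈ S, {μ | μ (cell s c) = 0})
      = ENNReal.ofReal (Real.exp (-(a * s ^ 2))) ^ S.card := by
  have hset : ⋂ c ∈ S, {μ : Measure E2 | μ (cell s c) = 0}
      = {μ | μ (⋃ c ∈ S, cell s c) = 0} := by
    ext μ
    simp
  rw [hset, poissonLaw_void ha (Finset.measurableSet_biUnion S fun c _ => measurableSet_cell s c)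
    ((Bornology.isBounded_biUnion_finset S).mpr fun c _ => Bornology.IsBounded.cell hs c),
    measureReal_biUnion_cell hs, ← ENNReal.ofReal_pow (Real.exp_nonneg _), ← Real.exp_nat_mul]
  ring_nf

lemma subIndep_convPow_void (ha : 0 ≤ a) {s : ℝ} (hs : 0 < s) (n : ℕ) :
    SubIndep (convPow (poissonLaw a) n) (fun c => {μ | μ (cell s c) = 0})
      (ENNReal.ofReal (Real.exp (-(a * s ^ 2))) ^ n) := by
  intro S
  have := isProbabilityMeasure_poissonLaw ha
  rw [convPow_apply_of_forall_add, poissonLaw_biInter_void ha hs, ← pow_mul, ← pow_mul, mul_comm n]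
  · exact Finset.measurableSet_biInter S fun c _ =>
      Measure.measurable_coe (measurableSet_cell s c) (measurableSet_singleton 0)
  · simp
  · intro μ ν
    simp [forall_and]

lemma poissonLaw_biInter_void_inter_biInter_occupied (ha : 0 ≤ a) {s : ℝ} (hs : 0 < s)
    (S : Finset (ℤ × ℤ)) : ∀ T : Finset (ℤ × ℤ), Disjoint S T →
    (poissonLaw a).real ((⋂ c ∈ T, {μ | μ (cell s c) = 0}) ∩ ⋂ c ∈ S, {μ | μ (cell s c) ≠ 0})
      = Real.exp (-(a * s ^ 2)) ^ T.card * (1 - Real.exp (-(a * s ^ 2))) ^ S.card := by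
  have := isProbabilityMeasure_poissonLaw ha
  induction S using Finset.induction_on with
  | empty =>
    intro T _
    simp [measureReal_def, poissonLaw_biInter_void ha hs,
      ENNReal.toReal_ofReal (Real.exp_nonneg _)]
  | insert b S hb ih =>
    intro T hT
    rw [Finset.disjoint_insert_left] at hT
    have h1 := ih T hT.2
    have h2 := ih (insert b T) (Finset.disjoint_insert_right.mpr ⟨hb, hT.2⟩)
    have hm : MeasurableSet {μ : Measure E2 | μ (cell s b) = 0} :=
      Measure.measurable_coe (measurableSet_cell s b) (measurableSet_singleton 0)
    rw [← measureReal_inter_add_sdiff hm] at h1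
    rw [Finset.card_insert_of_notMem hT.1] at h2
    rw [Finset.card_insert_of_notMem hb]
    have e1 : ((⋂ c ∈ T, {μ : Measure E2 | μ (cell s c) = 0})
        ∩ ⋂ c ∈ S, {μ : Measure E2 | μ (cell s c) ≠ 0}) ∩ {μ : Measure E2 | μ (cell s b) = 0}
        = (⋂ c ∈ insert b T, {μ : Measure E2 | μ (cell s c) = 0})
          ∩ ⋂ c ∈ S, {μ : Measure E2 | μ (cell s c) ≠ 0} := by
      rw [Finset.set_biInter_insert]
      ext μ
      simp only [Set.mem_inter_iff]
      tauto
    have e2 : ((⋂ c ∈ T, {μ : Measure E2 | μ (cell s c) = 0})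
        ∩ ⋂ c ∈ S, {μ : Measure E2 | μ (cell s c) ≠ 0}) \ {μ : Measure E2 | μ (cell s b) = 0}
        = (⋂ c ∈ T, {μ : Measure E2 | μ (cell s c) = 0})
          ∩ ⋂ c ∈ insert b S, {μ : Measure E2 | μ (cell s c) ≠ 0} := by
      rw [Finset.set_biInter_insert]
      ext μ
      simp only [Set.mem_inter_iff, Set.mem_sdiff, Set.mem_ofPred_eq]
      tauto
    rw [e1, e2, h2] at h1
    linear_combination h1

lemma subIndep_poissonLaw_occupied (ha : 0 ≤ a) {s : ℝ} (hs : 0 < s) :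
    SubIndep (poissonLaw a) (fun c => {μ | μ (cell s c) ≠ 0})
      (ENNReal.ofReal (1 - Real.exp (-(a * s ^ 2)))) := by
  intro S
  have := isProbabilityMeasure_poissonLaw ha
  have h := poissonLaw_biInter_void_inter_biInter_occupied ha hs S ∅ (Finset.disjoint_empty_right S)
  have h1 : 0 ≤ 1 - Real.exp (-(a * s ^ 2)) :=
    sub_nonneg.mpr (Real.exp_le_one_iff.mpr (by nlinarith [sq_nonneg s]))
  simp only [Finset.notMem_empty, Set.iInter_of_empty, Set.iInter_univ, Set.univ_inter,
    Finset.card_empty, pow_zero, one_mul] at h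
  rw [← ENNReal.ofReal_pow h1, ← h, ofReal_measureReal]

lemma poissonLaw_percolates_eq_zero (ha : 0 < a) :
    ∃ r₀ > 0, ∀ r ≤ r₀, poissonLaw a {μ | Percolates (BooleanModel μ r)} = 0 := by
  have h1 : 0 < 1 / (18 * (1 + a)) := by positivity
  set s := 1 / (18 * (1 + a)) with hs
  refine ⟨s / 4, by positivity, fun r hr => ?_⟩
  refine SubIndep.measure_percolates_eq_zero (Φ := fun μ => μ) h1 (by linarith) ?_
    (subIndep_poissonLaw_occupied ha.le h1)
  have hs1 : s ≤ 1 := by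
    rw [hs, div_le_one (by positivity)]
    linarith
  have hs2 : (1 + a) * s = 1 / 18 := by
    rw [hs]
    field_simp
  have hexp := Real.add_one_le_exp (-(a * s ^ 2))
  have hle : 1 - Real.exp (-(a * s ^ 2)) ≤ 1 / 18 := by
    nlinarith
  calc 9 * ENNReal.ofReal (1 - Real.exp (-(a * s ^ 2)))
      ≤ ENNReal.ofReal 9 * ENNReal.ofReal (1 / 18) := by
        rw [ENNReal.ofReal_ofNat]
        gcongr
    _ = 2⁻¹ := by
        rw [← ENNReal.ofReal_mul (by norm_num), show (9 : ℝ) * (1 / 18) = 2⁻¹ by norm_num,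
          ENNReal.ofReal_inv_of_pos (by norm_num), ENNReal.ofReal_ofNat]

lemma exists_poissonLaw_percolates_pos (ha : 0 < a) :
    ∃ r, 0 < poissonLaw a {μ | Percolates (BooleanModel μ r)} := by
  have := isProbabilityMeasure_poissonLaw ha.le
  have hs : 0 < 1 + 243 / a := by positivity
  set s := 1 + 243 / a with hsdef
  have h := subIndep_convPow_void ha.le hs 1
  rw [convPow_one, pow_one] at h
  refine ⟨3 * s, measure_percolates_pos (ae_isIntMeasure_poissonLaw ha.le) hs le_rfl ?_ h⟩
  have has : a * s = a + 243 := by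
    rw [hsdef]
    field_simp
  have hs1 : 1 ≤ s := by
    rw [hsdef]
    have : 0 < 243 / a := by positivity
    linarith
  have h243 : 243 ≤ a * s ^ 2 := by nlinarith
  have hexp := Real.add_one_le_exp (a * s ^ 2)
  have hle : Real.exp (-(a * s ^ 2)) ≤ 1 / 243 := by
    rw [Real.exp_neg, ← one_div]
    exact one_div_le_one_div_of_le (by norm_num) (by linarith)
  calc 81 * ENNReal.ofReal (Real.exp (-(a * s ^ 2)))
      ≤ ENNReal.ofReal 81 * ENNReal.ofReal (1 / 243) := by
        rw [ENNReal.ofReal_ofNat]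
        gcongr
    _ = 3⁻¹ := by
        rw [← ENNReal.ofReal_mul (by norm_num), show (81 : ℝ) * (1 / 243) = 3⁻¹ by norm_num,
          ENNReal.ofReal_inv_of_pos (by norm_num), ENNReal.ofReal_ofNat]

lemma exists_convPow_percolates_pos (ha : 0 < a) {r : ℝ} (hr : 0 < r) :
    ∃ n, 0 < convPow (poissonLaw a) n {μ | Percolates (BooleanModel μ r)} := by
  have := isProbabilityMeasure_poissonLaw ha.le
  have hs : 0 < r / 3 := by positivity
  have hq : ENNReal.ofReal (Real.exp (-(a * (r / 3) ^ 2))) < 1 := by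
    rw [ENNReal.ofReal_lt_one, Real.exp_lt_one_iff, neg_lt_zero]
    positivity
  have ht := ENNReal.Tendsto.const_mul (a := 81) (ENNReal.tendsto_pow_atTop_nhds_zero_of_lt_one hq)
    (Or.inr (by simp))
  rw [mul_zero] at ht
  obtain ⟨n, hn⟩ := (ht.eventually (gt_mem_nhds (show (0 : ℝ≥0∞) < 3⁻¹ by simp))).exists
  exact ⟨n, measure_percolates_pos (ae_convPow measurableSet_isIntMeasure isIntMeasure_zero
    (fun _ _ => IsIntMeasure.add) (ae_isIntMeasure_poissonLaw ha.le) n) hs (by linarith) hn.le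
    (subIndep_convPow_void ha.le hs n)⟩

lemma booleanModel_of_neg {μ : Measure E2} {r : ℝ} (hr : r < 0) : BooleanModel μ r = ∅ := by
  simp [BooleanModel, closedBall_eq_empty.mpr hr]

lemma not_percolates_empty : ¬ Percolates ∅ := by
  rintro ⟨C, hC, hconn, -⟩
  exact (hconn.nonempty.mono hC).ne_empty rfl

end Percolation

/-! ### Comparison in the directionally convex order -/

section Dcx

variable {Q : Measure (Measure E2)}

lemma measurePreserving_add_convPow (n : ℕ) :
    MeasurePreserving (fun p : Measure E2 × Measure E2 => p.1 + p.2)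
      ((convPow Q n).prod Q) (convPow Q (n + 1)) :=
  ⟨by fun_prop, rfl⟩

lemma ae_isIntMeasure_convPow (hQ : ∀ᵐ μ ∂Q, IsIntMeasure μ) (n : ℕ) :
    ∀ᵐ μ ∂convPow Q n, IsIntMeasure μ :=
  ae_convPow measurableSet_isIntMeasure isIntMeasure_zero (fun _ _ => IsIntMeasure.add) hQ n

lemma integral_comp_of_measurePreserving {α β : Type*} [MeasurableSpace α] [MeasurableSpace β]
    {μ : Measure α} {ν : Measure β} {g : α → β} (hg : MeasurePreserving g μ ν) {F : β → ℝ}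
    (hF : Measurable F) : ∫ x, F (g x) ∂μ = ∫ y, F y ∂ν := by
  rw [← hg.map_eq, integral_map hg.measurable.aemeasurable hF.aestronglyMeasurable]

variable [IsProbabilityMeasure Q] {k : ℕ} {B : Fin k → Set E2} {f : (Fin k → ℝ) → ℝ}

lemma two_mul_integral_convPow_le (hQ : ∀ᵐ μ ∂Q, IsIntMeasure μ)
    (hB : ∀ i, MeasurableSet (B i) ∧ Bornology.IsBounded (B i)) (hf : Measurable f)
    (hdcx : DirConvex f)
    (hInt : ∀ n, Integrable (fun μ : Measure E2 => f fun i => (μ (B i)).toReal) (convPow Q n))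
    (n : ℕ) :
    2 * ∫ μ, f (fun i => (μ (B i)).toReal) ∂convPow Q (n + 1)
      ≤ ∫ μ, f (fun i => (μ (B i)).toReal) ∂convPow Q n
        + ∫ μ, f (fun i => (μ (B i)).toReal) ∂convPow Q (n + 2) := by
  set F : Measure E2 → ℝ := fun μ => f fun i => (μ (B i)).toReal with hFdef
  have hF : Measurable F := hf.comp (measurable_pi_lambda _ fun i =>
    (Measure.measurable_coe (hB i).1).ennreal_toReal)
  let P := ((convPow Q n).prod Q).prod Q
  have g0 : MeasurePreserving (fun p : (Measure E2 × Measure E2) × Measure E2 => p.1.1) P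
      (convPow Q n) := measurePreserving_fst.comp measurePreserving_fst
  have g1 : MeasurePreserving (fun p : (Measure E2 × Measure E2) × Measure E2 => p.1.1 + p.1.2) P
      (convPow Q (n + 1)) := (measurePreserving_add_convPow n).comp measurePreserving_fst
  have g1' : MeasurePreserving (fun p : (Measure E2 × Measure E2) × Measure E2 => p.1.1 + p.2) P
      (convPow Q (n + 1)) := (measurePreserving_add_convPow n).comp
        (measurePreserving_fst.prod (MeasurePreserving.id Q))
  have g2 : MeasurePreserving
      (fun p : (Measure E2 × Measure E2) × Measure E2 => p.1.1 + p.1.2 + p.2) P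
      (convPow Q (n + 2)) := (measurePreserving_add_convPow (n + 1)).comp
        ((measurePreserving_add_convPow n).prod (MeasurePreserving.id Q))
  have hsnd : MeasurePreserving (fun p : (Measure E2 × Measure E2) × Measure E2 => p.1.2) P Q :=
    measurePreserving_snd.comp measurePreserving_fst
  have hsnd' : MeasurePreserving (fun p : (Measure E2 × Measure E2) × Measure E2 => p.2) P Q :=
    measurePreserving_snd
  have hae : ∀ᵐ p ∂P, F (p.1.1 + p.1.2) + F (p.1.1 + p.2)
      ≤ F p.1.1 + F (p.1.1 + p.1.2 + p.2) := by
    filter_upwards [g0.quasiMeasurePreserving.ae (ae_isIntMeasure_convPow hQ n),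
      hsnd.quasiMeasurePreserving.ae hQ, hsnd'.quasiMeasurePreserving.ae hQ] with p h1 h2 h3
    have hadd : ∀ {μ ν : Measure E2}, IsIntMeasure μ → IsIntMeasure ν →
        (fun i => ((μ + ν) (B i)).toReal)
          = (fun i => (μ (B i)).toReal) + fun i => (ν (B i)).toReal := by
      intro μ ν hμ hν
      ext i
      obtain ⟨m, hm⟩ := hμ _ (hB i).1 (hB i).2
      obtain ⟨n, hn⟩ := hν _ (hB i).1 (hB i).2
      rw [Measure.add_apply, Pi.add_apply, ENNReal.toReal_add (by simp [hm]) (by simp [hn])]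
    simp only [hFdef]
    rw [hadd (h1.add h2) h3, hadd h1 h2, hadd h1 h3]
    exact hdcx.add_add_le _ (fun i => ENNReal.toReal_nonneg) (fun i => ENNReal.toReal_nonneg)
  have i0 := g0.integrable_comp_of_integrable (hInt n)
  have i1 := g1.integrable_comp_of_integrable (hInt (n + 1))
  have i1' := g1'.integrable_comp_of_integrable (hInt (n + 1))
  have i2 := g2.integrable_comp_of_integrable (hInt (n + 2))
  have h := integral_mono_ae (i1.add i1') (i0.add i2) hae
  rw [integral_add' i1 i1', integral_add' i0 i2] at h
  simp only [Function.comp_def] at h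
  rw [integral_comp_of_measurePreserving g0 hF, integral_comp_of_measurePreserving g1 hF,
    integral_comp_of_measurePreserving g1' hF, integral_comp_of_measurePreserving g2 hF] at h
  linarith

lemma add_sub_one_mul_le_of_two_mul_le {h : ℕ → ℝ} (hh : ∀ n, 2 * h (n + 1) ≤ h n + h (n + 2))
    (n : ℕ) : h 1 + (n - 1) * (h 2 - h 1) ≤ h n := by
  cases n with
  | zero =>
    have := hh 0
    norm_num at this ⊢
    linarith
  | succ n =>
    have key : ∀ m : ℕ, h 2 - h 1 ≤ h (m + 2) - h (m + 1)
        ∧ h 1 + m * (h 2 - h 1) ≤ h (m + 1) := by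
      intro m
      induction m with
      | zero => simp
      | succ m ih =>
        have := hh (m + 1)
        refine ⟨by linarith [ih.1], ?_⟩
        push_cast
        linarith [ih.1, ih.2]
    simpa using (key n).2

lemma integral_le_integral_compoundPoisson (hQ : ∀ᵐ μ ∂Q, IsIntMeasure μ)
    (hB : ∀ i, MeasurableSet (B i) ∧ Bornology.IsBounded (B i)) (hf : Measurable f)
    (hdcx : DirConvex f)
    (hInt : Integrable (fun μ : Measure E2 => f fun i => (μ (B i)).toReal)
      (compoundPoisson 1 Q)) :
    ∫ μ, f (fun i => (μ (B i)).toReal) ∂Q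
      ≤ ∫ μ, f (fun i => (μ (B i)).toReal) ∂compoundPoisson 1 Q := by
  have hw : ∀ n : ℕ, 0 < Real.exp (-1) * 1 ^ n / n.factorial := fun n => by positivity
  have hintn : ∀ n, Integrable (fun μ : Measure E2 => f fun i => (μ (B i)).toReal)
      (convPow Q n) := by
    intro n
    have hn := hInt.mono_measure (Measure.le_sum (fun n : ℕ =>
      ENNReal.ofReal (Real.exp (-1) * 1 ^ n / n.factorial) • convPow Q n) n)
    exact (integrable_smul_measure (by simpa using hw n) ENNReal.ofReal_ne_top).mp hn
  have hsum := hasSum_integral_measure hInt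
  simp_rw [integral_smul_measure, ENNReal.toReal_ofReal (hw _).le, smul_eq_mul] at hsum
  set h : ℕ → ℝ := fun n => ∫ μ, f (fun i => (μ (B i)).toReal) ∂convPow Q n
  have hlow : HasSum (fun n : ℕ => Real.exp (-1) * 1 ^ n / n.factorial
      * (h 1 + (n - 1) * (h 2 - h 1))) (h 1) := by
    have h1 := (hasSum_poisson_weight 1).mul_right (h 1 - (h 2 - h 1))
    have h2 := (hasSum_poisson_weight_mul 1).mul_right (h 2 - h 1)
    convert! h1.add h2 using 1
    · ext n
      ring
    · ring
  have hle := hasSum_le (fun n => mul_le_mul_of_nonneg_left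
    (add_sub_one_mul_le_of_two_mul_le
      (two_mul_integral_convPow_le hQ hB hf hdcx hintn) n) (hw n).le) hlow hsum
  have h1 : h 1 = ∫ μ, f (fun i => (μ (B i)).toReal) ∂Q := by
    simp only [h, convPow_one]
  exact h1 ▸ hle

end Dcx

/-- for every `a > 0` there is a point process `Φ` of intensity `a`
(realized jointly with a homogeneous Poisson point process `Φpois` of intensity `a`
on a common probability space) that is dcx-larger than `Φpois` and whose Boolean model
percolates for every radius `r > 0`, i.e. `r_c(Φ) = 0`; in particular `Φ` witnesses the
failure of monotonicity of `r_c` in the dcx order, since `r_c(Φpois) > 0`. -/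
theorem super_poisson_with_null_critical_radius (a : ℝ) (ha : 0 < a) :
    ∃ Pr : Measure (Measure E2 × Measure E2), IsProbabilityMeasure Pr ∧
      -- the first coordinate process is Poisson of intensity `a`
      IsPoissonPP Pr (fun ω => ω.1) (ENNReal.ofReal a • (volume : Measure E2)) ∧
      -- the second coordinate process `Φ` is a point process
      (∀ᵐ ω ∂Pr, ∀ B : Set E2,
        MeasurableSet B → Bornology.IsBounded B → ∃ n : ℕ, ω.2 B = (n : ℝ≥0∞)) ∧
      -- `Φ` has intensity `a`
      (∀ B : Set E2, MeasurableSet B →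
        ∫⁻ ω, ω.2 B ∂Pr = ENNReal.ofReal a * volume B) ∧
      -- `Φ` is dcx-larger than the Poisson process
      DcxLE Pr (fun ω => ω.1) Pr (fun ω => ω.2) ∧
      -- `Φ` percolates for every positive radius
      criticalRadius Pr (fun ω => ω.2) = 0 ∧
      -- while the Poisson process has strictly positive critical radius
      0 < criticalRadius Pr (fun ω => ω.1) := by
  have := isProbabilityMeasure_poissonLaw ha.le
  have : IsProbabilityMeasure (compoundPoisson 1 (poissonLaw a)) :=
    isProbabilityMeasure_compoundPoisson zero_le_one
  have hQ := ae_isIntMeasure_poissonLaw ha.le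
  set Q := poissonLaw a
  set M := compoundPoisson 1 Q with hM
  have hfst : MeasurePreserving Prod.fst (Q.prod M) Q := measurePreserving_fst
  have hsnd : MeasurePreserving Prod.snd (Q.prod M) M := measurePreserving_snd
  have hfst_apply (p : Measure E2 → Prop) : (Q.prod M) {ω | p ω.1} = Q {μ | p μ} := by
    have hset : {ω : Measure E2 × Measure E2 | p ω.1} = {μ | p μ} ×ˢ Set.univ := by
      ext; simp
    rw [hset, Measure.prod_prod, measure_univ, mul_one]
  have hsnd_apply (p : Measure E2 → Prop) : (Q.prod M) {ω | p ω.2} = M {μ | p μ} := by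
    have hset : {ω : Measure E2 × Measure E2 | p ω.2} = Set.univ ×ˢ {μ | p μ} := by
      ext; simp
    rw [hset, Measure.prod_prod, measure_univ, one_mul]
  refine ⟨Q.prod M, inferInstance, ⟨measurable_fst, ?_⟩, ?_, ?_, ?_, ?_, ?_⟩
  · intro k B hB hd n
    rw [hfst_apply fun μ => ∀ i, μ (B i) = (n i : ℝ≥0∞)]
    exact poissonLaw_apply ha.le (fun j => (hB j).1) (fun j => (hB j).2) hd n
  · exact hsnd.quasiMeasurePreserving.ae (ae_mixPow (ae_isIntMeasure_convPow hQ))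
  · intro B hB
    rw [hsnd.lintegral_comp (f := fun μ : Measure E2 => μ B) (Measure.measurable_coe hB), hM,
      compoundPoisson, lintegral_mixPow_of_add (Measure.measurable_coe hB) (by simp) (by simp),
      tsum_poisson_weight_mul zero_le_one, ENNReal.ofReal_one, one_mul,
      lintegral_poissonLaw ha.le hB]
  · intro k B hB f hf hdcx _ hInt
    have hF : Measurable fun μ : Measure E2 => f fun i => (μ (B i)).toReal :=
      hf.comp (measurable_pi_lambda _ fun i => (Measure.measurable_coe (hB i).1).ennreal_toReal)
    rw [integral_comp_of_measurePreserving hfst hF, integral_comp_of_measurePreserving hsnd hF]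
    exact integral_le_integral_compoundPoisson hQ hB hf hdcx
      ((hsnd.integrable_comp hF.aestronglyMeasurable).mp hInt)
  · have hmem : ∀ r, 0 < r → 0 < (Q.prod M) {ω | Percolates (BooleanModel ω.2 r)} := by
      intro r hr
      rw [hsnd_apply fun μ => Percolates (BooleanModel μ r)]
      obtain ⟨n, hn⟩ := exists_convPow_percolates_pos ha hr
      refine lt_of_lt_of_le ?_ (Measure.le_sum (fun n : ℕ =>
        ENNReal.ofReal (Real.exp (-1) * 1 ^ n / n.factorial) • convPow Q n) n _)
      rw [Measure.smul_apply, smul_eq_mul]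
      refine ENNReal.mul_pos ?_ hn.ne'
      rw [Ne, ENNReal.ofReal_eq_zero, not_le]
      positivity
    have hnonneg : ∀ r ∈ {r : ℝ | 0 < (Q.prod M) {ω | Percolates (BooleanModel ω.2 r)}},
        0 ≤ r := by
      intro r hr
      by_contra! hneg
      simp [booleanModel_of_neg hneg, not_percolates_empty] at hr
    refine le_antisymm (le_of_forall_pos_le_add fun ε hε => ?_) (Real.sInf_nonneg hnonneg)
    rw [zero_add]
    exact csInf_le ⟨0, hnonneg⟩ (hmem ε hε)
  · obtain ⟨r₀, hr₀, hzero⟩ := poissonLaw_percolates_eq_zero ha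
    obtain ⟨r₁, hr₁⟩ := exists_poissonLaw_percolates_pos ha
    have happly (r : ℝ) := hfst_apply fun μ => Percolates (BooleanModel μ r)
    refine hr₀.trans_le (le_csInf ⟨r₁, ?_⟩ fun r hr => ?_)
    · rw [Set.mem_ofPred_eq, happly]
      exact hr₁
    · rw [Set.mem_ofPred_eq, happly] at hr
      by_contra! hlt
      exact hr.ne' (hzero r hlt.le)
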